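/- Conservativity: in a functional EPTS, suppose Γ ⊢ A type and let M be a Dedukti term with ⟦Γ⟧ ⊢ M : T, where T = El_{s_A} ⟦A⟧ (with Γ ⊢ A : s_A) or T = U_A (when A is a top-sort). Then M has a β-normal form NF_β(M), and Γ ⊢ |NF_β(M)| : A in the EPTS, with M reducing by β-steps to NF_β(M) and NF_β(M) ≡_H ⟦|NF_β(M)|⟧. -/

import Mathlib

namespace DKPaper

inductive Tm (C : Type) : Type
  | var : Nat → Tm C
  | const : C → List (Tm C) → Tm C
  | type : Tm C
  | kind : Tm C
  | app : Tm C → Tm C → Tm C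
  | lam : Tm C → Tm C → Tm C
  | pi : Tm C → Tm C → Tm C

namespace Tm
variable {C : Type}

def liftRen (ρ : Nat → Nat) : Nat → Nat
  | 0 => 0
  | n + 1 => ρ n + 1

def ren (ρ : Nat → Nat) : Tm C → Tm C
  | var n => var (ρ n)
  | const c Ms => const c (Ms.attach.map fun x => ren ρ x.1)
  | type => type
  | kind => kind
  | app M N => app (ren ρ M) (ren ρ N)
  | lam A M => lam (ren ρ A) (ren (liftRen ρ) M)
  | pi A B => pi (ren ρ A) (ren (liftRen ρ) B)
termination_by t => sizeOf t
decreasing_by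
  all_goals simp_wf
  all_goals try omega
  all_goals (have h := List.sizeOf_lt_of_mem x.2; omega)

def liftSub (σ : Nat → Tm C) : Nat → Tm C
  | 0 => var 0
  | n + 1 => ren Nat.succ (σ n)

def sub (σ : Nat → Tm C) : Tm C → Tm C
  | var n => σ n
  | const c Ms => const c (Ms.attach.map fun x => sub σ x.1)
  | type => type
  | kind => kind
  | app M N => app (sub σ M) (sub σ N)
  | lam A M => lam (sub σ A) (sub (liftSub σ) M)
  | pi A B => pi (sub σ A) (sub (liftSub σ) B)
termination_by t => sizeOf t
decreasing_by
  all_goals simp_wf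
  all_goals try omega
  all_goals (have h := List.sizeOf_lt_of_mem x.2; omega)

/-- Substitution of `N` for the variable of de Bruijn index `k` (the usual `M{N/x}`). -/
def substAt (k : Nat) (N : Tm C) : Tm C → Tm C :=
  sub fun n => if n < k then var n else if n = k then ren (· + k) N else var (n - 1)

end Tm

/-! ## Signatures, rewrite rules, rewriting -/

/-- An entry `c[Δ] : A` of a signature: head constant, telescope (in declaration
order, each entry a type under the previous ones), and the type. -/
abbrev Sig (C : Type) := Set (C × List (Tm C) × Tm C)

/-- A rewrite rule `c[l⃗] ↪ r`: head constant, list of left-hand side argument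
patterns (free de Bruijn variables are the pattern variables), right-hand side. -/
abbrev Rules (C : Type) := Set (C × List (Tm C) × Tm C)

variable {C : Type}

/-- Closure of a root relation under all term-forming contexts. -/
inductive Cong (r : Tm C → Tm C → Prop) : Tm C → Tm C → Prop
  | base {M N} : r M N → Cong r M N
  | appL {M M' N} : Cong r M M' → Cong r (.app M N) (.app M' N)
  | appR {M N N'} : Cong r N N' → Cong r (.app M N) (.app M N')
  | lamA {A A' M} : Cong r A A' → Cong r (.lam A M) (.lam A' M)
  | lamM {A M M'} : Cong r M M' → Cong r (.lam A M) (.lam A M')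
  | piA {A A' B} : Cong r A A' → Cong r (.pi A B) (.pi A' B)
  | piB {A B B'} : Cong r B B' → Cong r (.pi A B) (.pi A B')
  | constArg {c l₁ M M' l₂} : Cong r M M' →
      Cong r (.const c (l₁ ++ M :: l₂)) (.const c (l₁ ++ M' :: l₂))

/-- Root β-reduction. -/
def BetaRoot : Tm C → Tm C → Prop := fun M N =>
  ∃ A P Q, M = .app (.lam A P) Q ∧ N = Tm.substAt 0 Q P

/-- Root reduction by a rule of `R`: a substitution instance of some rule. -/
def RuleRoot (R : Rules C) : Tm C → Tm C → Prop := fun M N =>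
  ∃ rl ∈ R, ∃ σ : Nat → Tm C,
    M = Tm.sub σ (.const rl.1 rl.2.1) ∧ N = Tm.sub σ rl.2.2

/-- One-step β-reduction `↪_β`. -/
def Beta : Tm C → Tm C → Prop := Cong BetaRoot

/-- One-step reduction by the rules of `R` only (no β). -/
def RStep (R : Rules C) : Tm C → Tm C → Prop := Cong (RuleRoot R)

/-- One-step reduction `↪_{β𝓡}`. -/
def Step (R : Rules C) : Tm C → Tm C → Prop :=
  Cong (fun M N => BetaRoot M N ∨ RuleRoot R M N)

/-- The conversion `≡_{β𝓡}` generated by `↪_{β𝓡}`. -/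
def Conv (R : Rules C) : Tm C → Tm C → Prop := Relation.EqvGen (Step R)

/-- Confluence of an abstract reduction relation. -/
def Confluent {α : Type _} (r : α → α → Prop) : Prop :=
  ∀ a b c, Relation.ReflTransGen r a b → Relation.ReflTransGen r a c →
    ∃ d, Relation.ReflTransGen r b d ∧ Relation.ReflTransGen r c d

/-- `M` is in β-normal form. -/
def BetaNormal (M : Tm C) : Prop := ∀ N, ¬ Beta M N

/-- Strong normalization of a relation at a point: no infinite `r`-sequence starts at `a`. -/
def SN {α : Type _} (r : α → α → Prop) (a : α) : Prop := Acc (fun x y => r y x) a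

/-! ## Dedukti typing -/

/-- `IsDKSort s` means `s` is `TYPE` or `KIND`. -/
def IsDKSort (s : Tm C) : Prop := s = Tm.type ∨ s = Tm.kind

/-- `A{M⃗}`: simultaneous instantiation of the telescope variables by the arguments. -/
def instArgs (Ms : List (Tm C)) (A : Tm C) : Tm C :=
  Tm.sub (fun n => Ms.reverse.getD n (Tm.var (n - Ms.length))) A

/-- Instantiate the first variable of the (remaining) telescope `Δ` with `M`. -/
def instTele (M : Tm C) (Δ : List (Tm C)) : List (Tm C) :=
  Δ.mapIdx fun i B => Tm.substAt i M B

mutual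
/-- Well-formed contexts `Σ;Γ well-formed` (de Bruijn: last declaration first). -/
inductive Wf (S : Sig C) (R : Rules C) : List (Tm C) → Prop
  | empty : Wf S R []
  | decl {Γ A} : Typed S R Γ A Tm.type → Wf S R (A :: Γ)

/-- The Dedukti typing judgment `Σ;Γ ⊢ M : A`. -/
inductive Typed (S : Sig C) (R : Rules C) : List (Tm C) → Tm C → Tm C → Prop
  | sort {Γ} : Wf S R Γ → Typed S R Γ Tm.type Tm.kind
  | var {Γ n A} : Wf S R Γ → Γ[n]? = some A →
      Typed S R Γ (Tm.var n) (Tm.ren (· + (n + 1)) A)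
  | cons {Γ c Δ A s Ms} : (c, Δ, A) ∈ S → Typed S R Δ.reverse A s → IsDKSort s →
      TypedArgs S R Γ Ms Δ → Typed S R Γ (Tm.const c Ms) (instArgs Ms A)
  | conv {Γ M A B s} : Typed S R Γ M A → Typed S R Γ B s → IsDKSort s →
      Conv R A B → Typed S R Γ M B
  | prod {Γ A B s} : Typed S R Γ A Tm.type → Typed S R (A :: Γ) B s → IsDKSort s →
      Typed S R Γ (Tm.pi A B) s
  | abs {Γ A B s M} : Typed S R Γ A Tm.type → Typed S R (A :: Γ) B s → IsDKSort s →
      Typed S R (A :: Γ) M B → Typed S R Γ (Tm.lam A M) (Tm.pi A B)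
  | app {Γ M N A B} : Typed S R Γ M (Tm.pi A B) → Typed S R Γ N A →
      Typed S R Γ (Tm.app M N) (Tm.substAt 0 N B)

/-- `Σ;Γ ⊢ M⃗ : Δ`: the arguments fit the telescope. -/
inductive TypedArgs (S : Sig C) (R : Rules C) : List (Tm C) → List (Tm C) → List (Tm C) → Prop
  | nil {Γ} : TypedArgs S R Γ [] []
  | cons {Γ M Ms A Δ} : Typed S R Γ M A → TypedArgs S R Γ Ms (instTele M Δ) →
      TypedArgs S R Γ (M :: Ms) (A :: Δ)
end

/-! ## Type-level and object-level constants, syntactic classes -/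

/-- Types of the form `Πx⃗:B⃗.TYPE`. -/
inductive IsKindShape : Tm C → Prop
  | type : IsKindShape Tm.type
  | pi {A K} : IsKindShape K → IsKindShape (Tm.pi A K)

/-- `c` is a type-level constant of the signature `S`. -/
def TypeLevel (S : Sig C) (c : C) : Prop := ∃ Δ A, (c, Δ, A) ∈ S ∧ IsKindShape A

/-- `c` is an object-level constant of the signature `S`: it is declared, and not type-level. -/
def ObjLevel (S : Sig C) (c : C) : Prop := (∃ Δ A, (c, Δ, A) ∈ S) ∧ ¬ TypeLevel S c

mutual
/-- Kinds: `K ::= TYPE | Πx:T.K`. -/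
inductive IsKind (S : Sig C) : Tm C → Prop
  | type : IsKind S Tm.type
  | pi {T K} : IsTypeFam S T → IsKind S K → IsKind S (Tm.pi T K)

/-- Type families: `T ::= α[O⃗] | T O | λx:T.T | Πx:T.T` with `α` type-level. -/
inductive IsTypeFam (S : Sig C) : Tm C → Prop
  | const {c Os} : TypeLevel S c → (∀ O ∈ Os, IsObj S O) → IsTypeFam S (Tm.const c Os)
  | app {T O} : IsTypeFam S T → IsObj S O → IsTypeFam S (Tm.app T O)
  | lam {T₁ T₂} : IsTypeFam S T₁ → IsTypeFam S T₂ → IsTypeFam S (Tm.lam T₁ T₂)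
  | pi {T₁ T₂} : IsTypeFam S T₁ → IsTypeFam S T₂ → IsTypeFam S (Tm.pi T₁ T₂)

/-- Objects: `O ::= x | a[O⃗] | O O | λx:T.O` with `a` object-level. -/
inductive IsObj (S : Sig C) : Tm C → Prop
  | var {n} : IsObj S (Tm.var n)
  | const {c Os} : ObjLevel S c → (∀ O ∈ Os, IsObj S O) → IsObj S (Tm.const c Os)
  | app {O₁ O₂} : IsObj S O₁ → IsObj S O₂ → IsObj S (Tm.app O₁ O₂)
  | lam {T O} : IsTypeFam S T → IsObj S O → IsObj S (Tm.lam T O)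
end

mutual
/-- Pre-kinds: `L ::= TYPE | Πx:R.L`. -/
inductive PreKind (S : Sig C) : Tm C → Prop
  | type : PreKind S Tm.type
  | pi {R L} : PreTypeFam S R → PreKind S L → PreKind S (Tm.pi R L)

/-- Pre-type families: `R ::= α[M⃗] | R N | λx:A.R | Πx:R.R` with `α` type-level
and `M⃗`, `N`, `A` arbitrary. -/
inductive PreTypeFam (S : Sig C) : Tm C → Prop
  | const {c Ms} : TypeLevel S c → PreTypeFam S (Tm.const c Ms)
  | app {R N} : PreTypeFam S R → PreTypeFam S (Tm.app R N)
  | lam {A R} : PreTypeFam S R → PreTypeFam S (Tm.lam A R)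
  | pi {R₁ R₂} : PreTypeFam S R₁ → PreTypeFam S R₂ → PreTypeFam S (Tm.pi R₁ R₂)
end

/-- A rewrite rule is type-level when its head constant is type-level. -/
def TypeLevelRule (S : Sig C) (rl : C × List (Tm C) × Tm C) : Prop := TypeLevel S rl.1

/-- The grammar `R ::= α[M⃗] | R N | λx:A.R` used to define arity preservation. -/
inductive APShape (S : Sig C) : Tm C → Prop
  | const {c Ms} : TypeLevel S c → APShape S (Tm.const c Ms)
  | app {R N} : APShape S R → APShape S (Tm.app R N)
  | lam {A R} : APShape S R → APShape S (Tm.lam A R)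

/-- `𝓡` is arity preserving (w.r.t. `Σ`). -/
def ArityPreserving (S : Sig C) (R : Rules C) : Prop :=
  ∀ rl ∈ R, TypeLevelRule S rl → APShape S rl.2.2

/-- `𝓡` is well-formed (w.r.t. `Σ`): right-hand sides of type-level rules are in
the grammar `R ::= α[M⃗] | R N | λx:B.R | Πx:R.R`. -/
def RulesWellFormed (S : Sig C) (R : Rules C) : Prop :=
  ∀ rl ∈ R, TypeLevelRule S rl → PreTypeFam S rl.2.2

/-! ## Simple types and the erasure maps -/

/-- Simple types `σ ::= * | σ → σ`. -/
inductive STy : Type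
  | star : STy
  | arr : STy → STy → STy
deriving DecidableEq

open Classical in
/-- The partial type erasure `⌈·⌉` from Dedukti terms to simple types. -/
noncomputable def tyErase (S : Sig C) : Tm C → Option STy
  | Tm.type => some STy.star
  | Tm.const c _ => if TypeLevel S c then some STy.star else none
  | Tm.pi A B => do return STy.arr (← tyErase S A) (← tyErase S B)
  | Tm.app A _ => tyErase S A
  | Tm.lam _ B => tyErase S B
  | Tm.var _ => none
  | Tm.kind => none

/-- Untyped λ-terms with constants in `K` (the target of the term erasure). -/
inductive LTm (K : Type) : Type
  | var : Nat → LTm K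
  | const : K → LTm K
  | app : LTm K → LTm K → LTm K
  | lam : LTm K → LTm K

namespace LTm
variable {K : Type}

def liftRen' (ρ : Nat → Nat) : Nat → Nat
  | 0 => 0
  | n + 1 => ρ n + 1

def ren (ρ : Nat → Nat) : LTm K → LTm K
  | var n => var (ρ n)
  | const k => const k
  | app M N => app (ren ρ M) (ren ρ N)
  | lam M => lam (ren (liftRen' ρ) M)

/-- Shift free variables `≥ d` up by one. -/
def shiftAbove (d : Nat) : LTm K → LTm K :=
  ren fun n => if n < d then n else n + 1

def liftSub (σ : Nat → LTm K) : Nat → LTm K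
  | 0 => var 0
  | n + 1 => ren Nat.succ (σ n)

def sub (σ : Nat → LTm K) : LTm K → LTm K
  | var n => σ n
  | const k => const k
  | app M N => app (sub σ M) (sub σ N)
  | lam M => lam (sub (liftSub σ) M)

/-- Substitution `M{N/x}` for the variable of index `k`. -/
def substAt (k : Nat) (N : LTm K) : LTm K → LTm K :=
  sub fun n => if n < k then var n else if n = k then ren (· + k) N else var (n - 1)

end LTm

/-- β-reduction for the (simply-typed) λ-calculus. -/
inductive LBeta {K : Type} : LTm K → LTm K → Prop
  | red {M N} : LBeta (LTm.app (LTm.lam M) N) (LTm.substAt 0 N M)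
  | appL {M M' N} : LBeta M M' → LBeta (LTm.app M N) (LTm.app M' N)
  | appR {M N N'} : LBeta N N' → LBeta (LTm.app M N) (LTm.app M N')
  | lam {M M'} : LBeta M M' → LBeta (LTm.lam M) (LTm.lam M')

/-- The partial term erasure `|·|` from Dedukti terms into the λ-calculus with
constants `C ⊕ STy` (`Sum.inr σ` being the constant `π_σ`). -/
noncomputable def erase (S : Sig C) : Tm C → Option (LTm (C ⊕ STy))
  | Tm.var n => some (LTm.var n)
  | Tm.const c Ms => do
      let ts ← Ms.attach.mapM fun x => erase S x.1
      return ts.foldl LTm.app (LTm.const (Sum.inl c))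
  | Tm.app M N => do return LTm.app (← erase S M) (← erase S N)
  | Tm.lam A M => do
      return LTm.app (LTm.lam (LTm.lam (LTm.shiftAbove 1 (← erase S M)))) (← erase S A)
  | Tm.pi A B => do
      return LTm.app (LTm.app (LTm.const (Sum.inr (← tyErase S A))) (← erase S A))
        (LTm.lam (← erase S B))
  | Tm.type => none
  | Tm.kind => none
termination_by t => sizeOf t
decreasing_by
  all_goals simp_wf
  all_goals try omega
  all_goals (have h := List.sizeOf_lt_of_mem x.2; omega)

/-- The type `* → (σ → *) → *` of the constant `π_σ`. -/
def piConstTy (σ : STy) : STy := STy.arr STy.star (STy.arr (STy.arr σ STy.star) STy.star)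

/-- `⌈A₁⌉ → ... → ⌈Aₙ⌉ → ⌈A⌉`, as a relation (defined when all erasures are). -/
inductive EraseTele (S : Sig C) : List (Tm C) → Tm C → STy → Prop
  | nil {A σ} : tyErase S A = some σ → EraseTele S [] A σ
  | cons {B Δ A τ σ} : tyErase S B = some τ → EraseTele S Δ A σ →
      EraseTele S (B :: Δ) A (STy.arr τ σ)

/-- The simply-typed constant context `Γ_π, ⌈Σ'⌉`: it declares `π_σ : * → (σ → *) → *`
for every simple type `σ`, and `c : ⌈A₁⌉ → ... → ⌈Aₙ⌉ → ⌈A⌉` for every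
declaration `c[x₁:A₁,...,xₙ:Aₙ] : A` of `Σ'` (erasures being taken w.r.t. `S`). -/
inductive ConstTy (S : Sig C) (S' : Sig C) : C ⊕ STy → STy → Prop
  | piConst (σ : STy) : ConstTy S S' (Sum.inr σ) (piConstTy σ)
  | const {c Δ A σ} : (c, Δ, A) ∈ S' → EraseTele S Δ A σ → ConstTy S S' (Sum.inl c) σ

/-- Typing in the simply-typed λ-calculus, with constants typed by `cty`. -/
inductive STTyped {K : Type} (cty : K → STy → Prop) : List STy → LTm K → STy → Prop
  | var {Γ n σ} : Γ[n]? = some σ → STTyped cty Γ (LTm.var n) σ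
  | const {Γ k σ} : cty k σ → STTyped cty Γ (LTm.const k) σ
  | app {Γ M N σ τ} : STTyped cty Γ M (STy.arr σ τ) → STTyped cty Γ N σ →
      STTyped cty Γ (LTm.app M N) τ
  | lam {Γ M σ τ} : STTyped cty (σ :: Γ) M τ → STTyped cty Γ (LTm.lam M) (STy.arr σ τ)

/-! ## Explicitly-typed Pure Type Systems (EPTS) -/

/-- EPTS terms (de Bruijn): `x | s | Π_{s₁,s₂}(A,[x]B) | λ_{s₁,s₂}(A,[x]B,[x]M) |
@_{s₁,s₂}(A,[x]B,M,N)`. -/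
inductive ETm (S : Type) : Type
  | var : Nat → ETm S
  | sort : S → ETm S
  | pi : S → S → ETm S → ETm S → ETm S
  | lam : S → S → ETm S → ETm S → ETm S → ETm S
  | app : S → S → ETm S → ETm S → ETm S → ETm S → ETm S

namespace ETm
variable {S : Type}

def ren (ρ : Nat → Nat) : ETm S → ETm S
  | var n => var (ρ n)
  | sort s => sort s
  | pi s₁ s₂ A B => pi s₁ s₂ (ren ρ A) (ren (Tm.liftRen ρ) B)
  | lam s₁ s₂ A B M => lam s₁ s₂ (ren ρ A) (ren (Tm.liftRen ρ) B) (ren (Tm.liftRen ρ) M)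
  | app s₁ s₂ A B M N => app s₁ s₂ (ren ρ A) (ren (Tm.liftRen ρ) B) (ren ρ M) (ren ρ N)

def liftSub (σ : Nat → ETm S) : Nat → ETm S
  | 0 => var 0
  | n + 1 => ren Nat.succ (σ n)

def sub (σ : Nat → ETm S) : ETm S → ETm S
  | var n => σ n
  | sort s => sort s
  | pi s₁ s₂ A B => pi s₁ s₂ (sub σ A) (sub (liftSub σ) B)
  | lam s₁ s₂ A B M => lam s₁ s₂ (sub σ A) (sub (liftSub σ) B) (sub (liftSub σ) M)
  | app s₁ s₂ A B M N => app s₁ s₂ (sub σ A) (sub (liftSub σ) B) (sub σ M) (sub σ N)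

/-- Substitution `M{N/x}` for the variable of de Bruijn index `k`. -/
def substAt (k : Nat) (N : ETm S) : ETm S → ETm S :=
  sub fun n => if n < k then var n else if n = k then ren (· + k) N else var (n - 1)

end ETm

variable {S : Type}

/-- Closure of a root relation under all EPTS term-forming contexts. -/
inductive ECong (r : ETm S → ETm S → Prop) : ETm S → ETm S → Prop
  | base {M N} : r M N → ECong r M N
  | piA {s₁ s₂ A A' B} : ECong r A A' → ECong r (.pi s₁ s₂ A B) (.pi s₁ s₂ A' B)
  | piB {s₁ s₂ A B B'} : ECong r B B' → ECong r (.pi s₁ s₂ A B) (.pi s₁ s₂ A B')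
  | lamA {s₁ s₂ A A' B M} : ECong r A A' → ECong r (.lam s₁ s₂ A B M) (.lam s₁ s₂ A' B M)
  | lamB {s₁ s₂ A B B' M} : ECong r B B' → ECong r (.lam s₁ s₂ A B M) (.lam s₁ s₂ A B' M)
  | lamM {s₁ s₂ A B M M'} : ECong r M M' → ECong r (.lam s₁ s₂ A B M) (.lam s₁ s₂ A B M')
  | appA {s₁ s₂ A A' B M N} : ECong r A A' → ECong r (.app s₁ s₂ A B M N) (.app s₁ s₂ A' B M N)
  | appB {s₁ s₂ A B B' M N} : ECong r B B' → ECong r (.app s₁ s₂ A B M N) (.app s₁ s₂ A B' M N)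
  | appM {s₁ s₂ A B M M' N} : ECong r M M' → ECong r (.app s₁ s₂ A B M N) (.app s₁ s₂ A B M' N)
  | appN {s₁ s₂ A B M N N'} : ECong r N N' → ECong r (.app s₁ s₂ A B M N) (.app s₁ s₂ A B M N')

/-- Root β-reduction of the EPTS (linearized rule, one instance per `(s₁,s₂,s₃) ∈ ℛ`):
`@_{s₁,s₂}(A,[x]B, λ_{s₁,s₂}(A',[x]B',[x]M), N) ↪ M{N/x}`. -/
def EBetaRoot (Rrel : S → S → S → Prop) : ETm S → ETm S → Prop := fun M N =>
  ∃ s₁ s₂ s₃ A B A' B' P Q, Rrel s₁ s₂ s₃ ∧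
    M = ETm.app s₁ s₂ A B (ETm.lam s₁ s₂ A' B' P) Q ∧ N = ETm.substAt 0 Q P

/-- One-step EPTS reduction. -/
def EStep (Rrel : S → S → S → Prop) : ETm S → ETm S → Prop := ECong (EBetaRoot Rrel)

/-- EPTS conversion `≡`. -/
def EConv (Rrel : S → S → S → Prop) : ETm S → ETm S → Prop := Relation.EqvGen (EStep Rrel)

mutual
/-- Well-formed EPTS contexts. -/
inductive EWf (Ar : S → S → Prop) (Rr : S → S → S → Prop) : List (ETm S) → Prop
  | empty : EWf Ar Rr []
  | decl {Γ A s} : ETyped Ar Rr Γ A (ETm.sort s) → EWf Ar Rr (A :: Γ)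

/-- The EPTS typing judgment `Γ ⊢ M : A`. -/
inductive ETyped (Ar : S → S → Prop) (Rr : S → S → S → Prop) : List (ETm S) → ETm S → ETm S → Prop
  | sort {Γ s₁ s₂} : EWf Ar Rr Γ → Ar s₁ s₂ → ETyped Ar Rr Γ (ETm.sort s₁) (ETm.sort s₂)
  | var {Γ n A} : EWf Ar Rr Γ → Γ[n]? = some A →
      ETyped Ar Rr Γ (ETm.var n) (ETm.ren (· + (n + 1)) A)
  | conv {Γ M A B s} : ETyped Ar Rr Γ M A → ETyped Ar Rr Γ B (ETm.sort s) →
      EConv Rr A B → ETyped Ar Rr Γ M B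
  | pi {Γ s₁ s₂ s₃ A B} : Rr s₁ s₂ s₃ → ETyped Ar Rr Γ A (ETm.sort s₁) →
      ETyped Ar Rr (A :: Γ) B (ETm.sort s₂) →
      ETyped Ar Rr Γ (ETm.pi s₁ s₂ A B) (ETm.sort s₃)
  | lam {Γ s₁ s₂ s₃ A B M} : Rr s₁ s₂ s₃ → ETyped Ar Rr Γ A (ETm.sort s₁) →
      ETyped Ar Rr (A :: Γ) B (ETm.sort s₂) → ETyped Ar Rr (A :: Γ) M B →
      ETyped Ar Rr Γ (ETm.lam s₁ s₂ A B M) (ETm.pi s₁ s₂ A B)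
  | app {Γ s₁ s₂ s₃ A B M N} : Rr s₁ s₂ s₃ → ETyped Ar Rr Γ A (ETm.sort s₁) →
      ETyped Ar Rr (A :: Γ) B (ETm.sort s₂) → ETyped Ar Rr Γ N A →
      ETyped Ar Rr Γ M (ETm.pi s₁ s₂ A B) →
      ETyped Ar Rr Γ (ETm.app s₁ s₂ A B M N) (ETm.substAt 0 N B)
end

/-- `𝒜` and `ℛ` are functional relations. -/
def FunctionalSpec (Ar : S → S → Prop) (Rr : S → S → S → Prop) : Prop :=
  (∀ s t t', Ar s t → Ar s t' → t = t') ∧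
  (∀ s₁ s₂ t t', Rr s₁ s₂ t → Rr s₁ s₂ t' → t = t')

/-- `s` is a top-sort. -/
def IsTopSort (Ar : S → S → Prop) (s : S) : Prop := ¬ ∃ s', Ar s s'

/-- `Γ ⊢ A type`: `A` is a sort, or `Γ ⊢ A : s` for some sort `s`. -/
def ETypeJ (Ar : S → S → Prop) (Rr : S → S → S → Prop) (Γ : List (ETm S)) (A : ETm S) : Prop :=
  (∃ s, A = ETm.sort s) ∨ ∃ s, ETyped Ar Rr Γ A (ETm.sort s)

/-! ## (Implicit) Pure Type Systems -/

/-- PTS terms. -/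
inductive PTm (S : Type) : Type
  | var : Nat → PTm S
  | sort : S → PTm S
  | pi : PTm S → PTm S → PTm S
  | lam : PTm S → PTm S → PTm S
  | app : PTm S → PTm S → PTm S

namespace PTm
variable {S : Type}

def ren (ρ : Nat → Nat) : PTm S → PTm S
  | var n => var (ρ n)
  | sort s => sort s
  | pi A B => pi (ren ρ A) (ren (Tm.liftRen ρ) B)
  | lam A M => lam (ren ρ A) (ren (Tm.liftRen ρ) M)
  | app M N => app (ren ρ M) (ren ρ N)

def liftSub (σ : Nat → PTm S) : Nat → PTm S
  | 0 => var 0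
  | n + 1 => ren Nat.succ (σ n)

def sub (σ : Nat → PTm S) : PTm S → PTm S
  | var n => σ n
  | sort s => sort s
  | pi A B => pi (sub σ A) (sub (liftSub σ) B)
  | lam A M => lam (sub σ A) (sub (liftSub σ) M)
  | app M N => app (sub σ M) (sub σ N)

def substAt (k : Nat) (N : PTm S) : PTm S → PTm S :=
  sub fun n => if n < k then var n else if n = k then ren (· + k) N else var (n - 1)

end PTm

/-- One-step β-reduction of PTS terms. -/
inductive PBeta : PTm S → PTm S → Prop
  | red {A M N} : PBeta (PTm.app (PTm.lam A M) N) (PTm.substAt 0 N M)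
  | piA {A A' B} : PBeta A A' → PBeta (PTm.pi A B) (PTm.pi A' B)
  | piB {A B B'} : PBeta B B' → PBeta (PTm.pi A B) (PTm.pi A B')
  | lamA {A A' M} : PBeta A A' → PBeta (PTm.lam A M) (PTm.lam A' M)
  | lamM {A M M'} : PBeta M M' → PBeta (PTm.lam A M) (PTm.lam A M')
  | appL {M M' N} : PBeta M M' → PBeta (PTm.app M N) (PTm.app M' N)
  | appR {M N N'} : PBeta N N' → PBeta (PTm.app M N) (PTm.app M N')

/-- PTS conversion. -/
def PConv : PTm S → PTm S → Prop := Relation.EqvGen PBeta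

mutual
/-- Well-formed PTS contexts. -/
inductive PWf (Ar : S → S → Prop) (Rr : S → S → S → Prop) : List (PTm S) → Prop
  | empty : PWf Ar Rr []
  | decl {Γ A s} : PTyped Ar Rr Γ A (PTm.sort s) → PWf Ar Rr (A :: Γ)

/-- The PTS typing judgment. -/
inductive PTyped (Ar : S → S → Prop) (Rr : S → S → S → Prop) : List (PTm S) → PTm S → PTm S → Prop
  | sort {Γ s₁ s₂} : PWf Ar Rr Γ → Ar s₁ s₂ → PTyped Ar Rr Γ (PTm.sort s₁) (PTm.sort s₂)
  | var {Γ n A} : PWf Ar Rr Γ → Γ[n]? = some A →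
      PTyped Ar Rr Γ (PTm.var n) (PTm.ren (· + (n + 1)) A)
  | conv {Γ M A B s} : PTyped Ar Rr Γ M A → PTyped Ar Rr Γ B (PTm.sort s) →
      PConv A B → PTyped Ar Rr Γ M B
  | pi {Γ s₁ s₂ s₃ A B} : Rr s₁ s₂ s₃ → PTyped Ar Rr Γ A (PTm.sort s₁) →
      PTyped Ar Rr (A :: Γ) B (PTm.sort s₂) →
      PTyped Ar Rr Γ (PTm.pi A B) (PTm.sort s₃)
  | lam {Γ s₁ s₂ s₃ A B M} : Rr s₁ s₂ s₃ → PTyped Ar Rr Γ A (PTm.sort s₁) →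
      PTyped Ar Rr (A :: Γ) B (PTm.sort s₂) → PTyped Ar Rr (A :: Γ) M B →
      PTyped Ar Rr Γ (PTm.lam A M) (PTm.pi A B)
  | app {Γ A B M N} : PTyped Ar Rr Γ M (PTm.pi A B) → PTyped Ar Rr Γ N A →
      PTyped Ar Rr Γ (PTm.app M N) (PTm.substAt 0 N B)
end

/-- `Γ ⊢_PTS A type`. -/
def PTypeJ (Ar : S → S → Prop) (Rr : S → S → S → Prop) (Γ : List (PTm S)) (A : PTm S) : Prop :=
  (∃ s, A = PTm.sort s) ∨ ∃ s, PTyped Ar Rr Γ A (PTm.sort s)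

/-- The natural erasure from EPTS terms to PTS terms. -/
def epsErase : ETm S → PTm S
  | ETm.var n => PTm.var n
  | ETm.sort s => PTm.sort s
  | ETm.pi _ _ A B => PTm.pi (epsErase A) (epsErase B)
  | ETm.lam _ _ A _ M => PTm.lam (epsErase A) (epsErase M)
  | ETm.app _ _ _ _ M N => PTm.app (epsErase M) (epsErase N)

/-! ## The encoding of EPTSs in Dedukti -/

/-- The constants of the theory `(Σ_EPTS, 𝓡_EPTS)`. -/
inductive EConst (S : Type) : Type
  | U : S → EConst S
  | El : S → EConst S
  | u : S → EConst S
  | Prod : S → S → EConst S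
  | abs : S → S → EConst S
  | app : S → S → EConst S

/-- `U_s`. -/
def Ucon (s : S) : Tm (EConst S) := Tm.const (EConst.U s) []
/-- `El_s A`. -/
def Elcon (s : S) (A : Tm (EConst S)) : Tm (EConst S) := Tm.const (EConst.El s) [A]
/-- `u_s`. -/
def ucon (s : S) : Tm (EConst S) := Tm.const (EConst.u s) []
/-- `Prod_{s₁,s₂} A B`. -/
def ProdC (s₁ s₂ : S) (A B : Tm (EConst S)) : Tm (EConst S) :=
  Tm.const (EConst.Prod s₁ s₂) [A, B]
/-- `abs_{s₁,s₂} A B M`. -/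
def absC (s₁ s₂ : S) (A B M : Tm (EConst S)) : Tm (EConst S) :=
  Tm.const (EConst.abs s₁ s₂) [A, B, M]
/-- `app_{s₁,s₂} A B M N`. -/
def appC (s₁ s₂ : S) (A B M N : Tm (EConst S)) : Tm (EConst S) :=
  Tm.const (EConst.app s₁ s₂) [A, B, M, N]

/-- The signature `Σ_EPTS` (telescopes in de Bruijn form). -/
inductive SigEPTSMem (Ar : S → S → Prop) (Rr : S → S → S → Prop) :
    EConst S × List (Tm (EConst S)) × Tm (EConst S) → Prop
  | U (s : S) : SigEPTSMem Ar Rr (EConst.U s, [], Tm.type)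
  | El (s : S) : SigEPTSMem Ar Rr (EConst.El s, [Ucon s], Tm.type)
  | u {s₁ s₂} : Ar s₁ s₂ → SigEPTSMem Ar Rr (EConst.u s₁, [], Ucon s₂)
  | Prod {s₁ s₂ s₃} : Rr s₁ s₂ s₃ →
      SigEPTSMem Ar Rr (EConst.Prod s₁ s₂,
        [Ucon s₁, Tm.pi (Elcon s₁ (Tm.var 0)) (Ucon s₂)],
        Ucon s₃)
  | abs {s₁ s₂ s₃} : Rr s₁ s₂ s₃ →
      SigEPTSMem Ar Rr (EConst.abs s₁ s₂,
        [Ucon s₁, Tm.pi (Elcon s₁ (Tm.var 0)) (Ucon s₂),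
         Tm.pi (Elcon s₁ (Tm.var 1)) (Elcon s₂ (Tm.app (Tm.var 1) (Tm.var 0)))],
        Elcon s₃ (ProdC s₁ s₂ (Tm.var 2) (Tm.var 1)))
  | app {s₁ s₂ s₃} : Rr s₁ s₂ s₃ →
      SigEPTSMem Ar Rr (EConst.app s₁ s₂,
        [Ucon s₁, Tm.pi (Elcon s₁ (Tm.var 0)) (Ucon s₂),
         Elcon s₃ (ProdC s₁ s₂ (Tm.var 1) (Tm.var 0)),
         Elcon s₁ (Tm.var 2)],
        Elcon s₂ (Tm.app (Tm.var 2) (Tm.var 0)))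

/-- `Σ_EPTS` as a signature. -/
def sigEPTS (Ar : S → S → Prop) (Rr : S → S → S → Prop) : Sig (EConst S) :=
  fun e => SigEPTSMem Ar Rr e

/-- The rules `El_{s₂} u_{s₁} ↪ U_{s₁}` for `(s₁,s₂) ∈ 𝒜`. -/
inductive URulesMem (Ar : S → S → Prop) :
    EConst S × List (Tm (EConst S)) × Tm (EConst S) → Prop
  | u_red {s₁ s₂} : Ar s₁ s₂ → URulesMem Ar (EConst.El s₂, [ucon s₁], Ucon s₁)

/-- The rules `app_{s₁,s₂} A B (abs_{s₁,s₂} A' B' M) N ↪ M N` for `(s₁,s₂,s₃) ∈ ℛ`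
(pattern variables `A,B,A',B',M,N` are the de Bruijn variables `0,…,5`). -/
inductive BetaRulesMem (Rr : S → S → S → Prop) :
    EConst S × List (Tm (EConst S)) × Tm (EConst S) → Prop
  | beta {s₁ s₂ s₃} : Rr s₁ s₂ s₃ →
      BetaRulesMem Rr (EConst.app s₁ s₂,
        [Tm.var 0, Tm.var 1, absC s₁ s₂ (Tm.var 2) (Tm.var 3) (Tm.var 4), Tm.var 5],
        Tm.app (Tm.var 4) (Tm.var 5))

/-- The `u_{s₁}`-red rules as a rule set. -/
def uRules (Ar : S → S → Prop) : Rules (EConst S) := fun e => URulesMem Ar e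

/-- The `beta_{s₁,s₂}` rules as a rule set. -/
def betaRules (Rr : S → S → S → Prop) : Rules (EConst S) := fun e => BetaRulesMem Rr e

/-- The rewrite system `𝓡_EPTS`. -/
def rulesEPTS (Ar : S → S → Prop) (Rr : S → S → S → Prop) : Rules (EConst S) :=
  uRules Ar ∪ betaRules Rr

/-- The translation `⟦·⟧` from EPTS terms to Dedukti terms. -/
def trans : ETm S → Tm (EConst S)
  | ETm.var n => Tm.var n
  | ETm.sort s => ucon s
  | ETm.pi s₁ s₂ A B =>
      ProdC s₁ s₂ (trans A) (Tm.lam (Elcon s₁ (trans A)) (trans B))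
  | ETm.lam s₁ s₂ A B M =>
      absC s₁ s₂ (trans A) (Tm.lam (Elcon s₁ (trans A)) (trans B))
        (Tm.lam (Elcon s₁ (trans A)) (trans M))
  | ETm.app s₁ s₂ A B M N =>
      appC s₁ s₂ (trans A) (Tm.lam (Elcon s₁ (trans A)) (trans B)) (trans M) (trans N)

/-- The translation `⟦·⟧` on (well-formed) contexts: `⟦Γ, x:A⟧ = ⟦Γ⟧, x : El_{s_A} ⟦A⟧`
where `Γ ⊢ A : s_A`. -/
inductive TransCtx (Ar : S → S → Prop) (Rr : S → S → S → Prop) :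
    List (ETm S) → List (Tm (EConst S)) → Prop
  | nil : TransCtx Ar Rr [] []
  | cons {Γ Δ A sA} : TransCtx Ar Rr Γ Δ → ETyped Ar Rr Γ A (ETm.sort sA) →
      TransCtx Ar Rr (A :: Γ) (Elcon sA (trans A) :: Δ)

/-- Invertible forms. -/
inductive Invertible : Tm (EConst S) → Prop
  | var {n} : Invertible (Tm.var n)
  | u {s} : Invertible (ucon s)
  | abs {s₁ s₂ A T₁ B T₂ M} : Invertible A → Invertible B → Invertible M →
      Invertible (absC s₁ s₂ A (Tm.lam T₁ B) (Tm.lam T₂ M))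
  | beta {T M N} : Invertible M → Invertible N →
      Invertible (Tm.app (Tm.lam T M) N)
  | prod {s₁ s₂ A T₁ B} : Invertible A → Invertible B →
      Invertible (ProdC s₁ s₂ A (Tm.lam T₁ B))
  | app {s₁ s₂ A T₁ B M N} : Invertible A → Invertible B → Invertible M → Invertible N →
      Invertible (appC s₁ s₂ A (Tm.lam T₁ B) M N)

/-- The inverse translation `|·|`, defined (at least) on invertible forms. -/
def inv : Tm (EConst S) → Option (ETm S)
  | Tm.var n => some (ETm.var n)
  | Tm.const (EConst.u s) [] => some (ETm.sort s)
  | Tm.app (Tm.lam _ M) N => do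
      return ETm.substAt 0 (← inv N) (← inv M)
  | Tm.const (EConst.Prod s₁ s₂) [A, Tm.lam _ B] => do
      return ETm.pi s₁ s₂ (← inv A) (← inv B)
  | Tm.const (EConst.abs s₁ s₂) [A, Tm.lam _ B, Tm.lam _ M] => do
      return ETm.lam s₁ s₂ (← inv A) (← inv B) (← inv M)
  | Tm.const (EConst.app s₁ s₂) [A, Tm.lam _ B, M, N] => do
      return ETm.app s₁ s₂ (← inv A) (← inv B) (← inv M) (← inv N)
  | _ => none
termination_by t => sizeOf t
decreasing_by
  all_goals simp_wf
  all_goals omega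

/-- Hidden rewriting steps: a `↪_{β𝓡}` step inside the type annotation of a binder. -/
def HStep (R : Rules (EConst S)) : Tm (EConst S) → Tm (EConst S) → Prop :=
  Cong fun M N => ∃ A A' P, Step R A A' ∧ M = Tm.lam A P ∧ N = Tm.lam A' P

/-- The hidden conversion `≡_H`. -/
def HConv (R : Rules (EConst S)) : Tm (EConst S) → Tm (EConst S) → Prop :=
  Relation.EqvGen (HStep R)

/-! ## Substitution calculus -/

/-- The substitution sending `0` to `N` and `n + 1` to `σ n`. -/
def scons {α : Type} (N : α) (σ : Nat → α) : Nat → α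
  | 0 => N
  | n + 1 => σ n

@[simp] theorem scons_zero {α : Type} (N : α) (σ : Nat → α) : scons N σ 0 = N := rfl

@[simp] theorem scons_succ {α : Type} (N : α) (σ : Nat → α) (n : Nat) :
    scons N σ (n + 1) = σ n := rfl

namespace Tm

@[simp] theorem ren_const (ρ : Nat → Nat) (c : C) (Ms : List (Tm C)) :
    ren ρ (const c Ms) = const c (Ms.map (ren ρ)) := by
  rw [ren, List.attach_map_val (f := ren ρ)]

@[simp] theorem sub_const (σ : Nat → Tm C) (c : C) (Ms : List (Tm C)) :
    sub σ (const c Ms) = const c (Ms.map (sub σ)) := by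
  rw [sub, List.attach_map_val (f := sub σ)]

attribute [simp] ren.eq_1 ren.eq_3 ren.eq_4 ren.eq_5 ren.eq_6 ren.eq_7
attribute [simp] sub.eq_1 sub.eq_3 sub.eq_4 sub.eq_5 sub.eq_6 sub.eq_7

/-- Induction on terms, with an induction hypothesis for every argument of a constant. -/
theorem ind {P : Tm C → Prop} (var : ∀ n, P (.var n))
    (const : ∀ c Ms, (∀ M ∈ Ms, P M) → P (.const c Ms)) (type : P .type) (kind : P .kind)
    (app : ∀ M N, P M → P N → P (.app M N)) (lam : ∀ A M, P A → P M → P (.lam A M))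
    (pi : ∀ A B, P A → P B → P (.pi A B)) (M : Tm C) : P M := by
  refine Tm.rec (motive_1 := P) (motive_2 := fun Ms => ∀ M ∈ Ms, P M) var const type kind app
    lam pi ?_ ?_ M
  · simp
  · intro M Ms hM hMs
    simpa using ⟨hM, hMs⟩

theorem liftSub_var (ρ : Nat → Nat) :
    liftSub (fun n => (var (ρ n) : Tm C)) = fun n => var (liftRen ρ n) := by
  funext n
  cases n <;> simp [liftSub, liftRen]

theorem ren_eq_sub (M : Tm C) : ∀ ρ : Nat → Nat, ren ρ M = sub (fun n => var (ρ n)) M := by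
  induction M using ind <;> intro ρ <;> simp_all [liftSub_var]

@[simp] theorem sub_var_id (M : Tm C) : sub var M = M := by
  have lift : liftSub (var : Nat → Tm C) = var := by
    funext n
    cases n <;> simp [liftSub]
  induction M using ind with
  | const c Ms ih =>
    rw [sub_const, List.map_congr_left ih]
    simp
  | _ => simp_all

theorem sub_ren (M : Tm C) : ∀ (ρ : Nat → Nat) (σ : Nat → Tm C),
    sub σ (ren ρ M) = sub (fun n => σ (ρ n)) M := by
  have lift : ∀ (ρ : Nat → Nat) (σ : Nat → Tm C),
      (fun n => liftSub σ (liftRen ρ n)) = liftSub (fun n => σ (ρ n)) := by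
    intro ρ σ
    funext n
    cases n <;> rfl
  induction M using ind <;> intro ρ σ <;> simp_all

theorem ren_ren (M : Tm C) (ρ ρ' : Nat → Nat) : ren ρ' (ren ρ M) = ren (fun n => ρ' (ρ n)) M := by
  rw [ren_eq_sub _ ρ', sub_ren, ren_eq_sub]

theorem ren_sub (M : Tm C) : ∀ (σ : Nat → Tm C) (ρ : Nat → Nat),
    ren ρ (sub σ M) = sub (fun n => ren ρ (σ n)) M := by
  have lift : ∀ (σ : Nat → Tm C) (ρ : Nat → Nat),
      (fun n => ren (liftRen ρ) (liftSub σ n)) = liftSub (fun n => ren ρ (σ n)) := by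
    intro σ ρ
    funext n
    cases n
    · simp [liftSub, liftRen]
    · simp only [liftSub, ren_ren]
      rfl
  induction M using ind <;> intro σ ρ <;> simp_all

theorem sub_sub (M : Tm C) : ∀ σ τ : Nat → Tm C,
    sub τ (sub σ M) = sub (fun n => sub τ (σ n)) M := by
  have lift : ∀ σ τ : Nat → Tm C,
      (fun n => sub (liftSub τ) (liftSub σ n)) = liftSub (fun n => sub τ (σ n)) := by
    intro σ τ
    funext n
    cases n
    · simp [liftSub]
    · simp only [liftSub, sub_ren, ren_sub]
  induction M using ind <;> intro σ τ <;> simp_all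

theorem substAt_zero (N M : Tm C) : substAt 0 N M = sub (scons N var) M := by
  unfold substAt
  congr 1
  funext n
  cases n
  · simp [ren_eq_sub]
  · simp

theorem sub_liftSub_scons (M N : Tm C) (σ : Nat → Tm C) :
    sub (scons N var) (sub (liftSub σ) M) = sub (scons N σ) M := by
  rw [sub_sub]
  congr 1
  funext n
  cases n
  · simp [liftSub]
  · simp only [liftSub, sub_ren, scons_succ]
    exact sub_var_id _

theorem sub_substAt_zero (M N : Tm C) (σ : Nat → Tm C) :
    sub σ (substAt 0 N M) = substAt 0 (sub σ N) (sub (liftSub σ) M) := by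
  rw [substAt_zero, substAt_zero, sub_liftSub_scons, sub_sub]
  congr 1
  funext n
  cases n <;> simp

end Tm

namespace ETm

theorem liftSub_var (ρ : Nat → Nat) :
    liftSub (fun n => (var (ρ n) : ETm S)) = fun n => var (Tm.liftRen ρ n) := by
  funext n
  cases n <;> simp [liftSub, Tm.liftRen, ren]

theorem ren_eq_sub (M : ETm S) : ∀ ρ : Nat → Nat, ren ρ M = sub (fun n => var (ρ n)) M := by
  induction M <;> intro ρ <;> simp_all [liftSub_var, ren, sub]

@[simp] theorem sub_var_id (M : ETm S) : sub var M = M := by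
  have lift : liftSub (var : Nat → ETm S) = var := by
    funext n
    cases n <;> simp [liftSub, ren]
  induction M <;> simp_all [sub]

theorem sub_ren (M : ETm S) : ∀ (ρ : Nat → Nat) (σ : Nat → ETm S),
    sub σ (ren ρ M) = sub (fun n => σ (ρ n)) M := by
  have lift : ∀ (ρ : Nat → Nat) (σ : Nat → ETm S),
      (fun n => liftSub σ (Tm.liftRen ρ n)) = liftSub (fun n => σ (ρ n)) := by
    intro ρ σ
    funext n
    cases n <;> rfl
  induction M <;> intro ρ σ <;> simp_all [sub, ren]

theorem ren_ren (M : ETm S) (ρ ρ' : Nat → Nat) : ren ρ' (ren ρ M) = ren (fun n => ρ' (ρ n)) M := by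
  rw [ren_eq_sub _ ρ', sub_ren, ren_eq_sub]

theorem ren_sub (M : ETm S) : ∀ (σ : Nat → ETm S) (ρ : Nat → Nat),
    ren ρ (sub σ M) = sub (fun n => ren ρ (σ n)) M := by
  have lift : ∀ (σ : Nat → ETm S) (ρ : Nat → Nat),
      (fun n => ren (Tm.liftRen ρ) (liftSub σ n)) = liftSub (fun n => ren ρ (σ n)) := by
    intro σ ρ
    funext n
    cases n
    · rfl
    · simp only [liftSub, ren_ren]
      rfl
  induction M <;> intro σ ρ <;> simp_all [sub, ren]

theorem sub_sub (M : ETm S) : ∀ σ τ : Nat → ETm S,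
    sub τ (sub σ M) = sub (fun n => sub τ (σ n)) M := by
  have lift : ∀ σ τ : Nat → ETm S,
      (fun n => sub (liftSub τ) (liftSub σ n)) = liftSub (fun n => sub τ (σ n)) := by
    intro σ τ
    funext n
    cases n
    · rfl
    · simp only [liftSub, sub_ren, ren_sub]
  induction M <;> intro σ τ <;> simp_all [sub]

theorem substAt_zero (N M : ETm S) : substAt 0 N M = sub (scons N var) M := by
  unfold substAt
  congr 1
  funext n
  cases n
  · simp [ren_eq_sub]
  · simp

theorem sub_substAt_zero (M N : ETm S) (σ : Nat → ETm S) :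
    sub σ (substAt 0 N M) = substAt 0 (sub σ N) (sub (liftSub σ) M) := by
  rw [substAt_zero, substAt_zero, sub_sub, sub_sub]
  congr 1
  funext n
  cases n
  · rfl
  · simp only [liftSub, sub_ren, scons_succ, sub]
    exact (sub_var_id _).symm

end ETm

theorem trans_ren (M : ETm S) : ∀ ρ : Nat → Nat, trans (M.ren ρ) = (trans M).ren ρ := by
  induction M <;> intro ρ <;>
    simp_all [trans, ETm.ren, ucon, ProdC, absC, appC, Elcon]

theorem trans_sub (M : ETm S) : ∀ σ : Nat → ETm S,
    trans (M.sub σ) = (trans M).sub fun n => trans (σ n) := by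
  have lift : ∀ σ : Nat → ETm S,
      (fun n => trans (ETm.liftSub σ n)) = Tm.liftSub fun n => trans (σ n) := by
    intro σ
    funext n
    cases n
    · rfl
    · simp only [ETm.liftSub, Tm.liftSub, trans_ren]
  induction M <;> intro σ <;>
    simp_all [trans, ETm.sub, ucon, ProdC, absC, appC, Elcon]

theorem trans_substAt_zero (M N : ETm S) :
    trans (ETm.substAt 0 N M) = Tm.substAt 0 (trans N) (trans M) := by
  rw [ETm.substAt_zero, Tm.substAt_zero, trans_sub]
  congr 1
  funext n
  cases n <;> rfl

/-! ## Congruence of conversion -/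

section Congruence

open Relation

variable {r : Tm C → Tm C → Prop}

theorem eqvGen_lift {α β : Type} {p : α → α → Prop} {q : β → β → Prop} (f : α → β)
    (hf : ∀ a b, p a b → EqvGen q (f a) (f b)) {a b : α} (h : EqvGen p a b) :
    EqvGen q (f a) (f b) := by
  induction h with
  | rel _ _ h => exact hf _ _ h
  | refl => exact .refl _
  | symm _ _ _ ih => exact ih.symm
  | trans _ _ _ _ _ ih₁ ih₂ => exact ih₁.trans _ _ _ ih₂

theorem eqvGen_app {M M' N N' : Tm C} (hM : EqvGen (Cong r) M M') (hN : EqvGen (Cong r) N N') :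
    EqvGen (Cong r) (.app M N) (.app M' N') :=
  .trans _ _ _ (eqvGen_lift (fun X => Tm.app X N) (fun _ _ h => .rel _ _ (.appL h)) hM)
    (eqvGen_lift (fun X => Tm.app M' X) (fun _ _ h => .rel _ _ (.appR h)) hN)

theorem eqvGen_lam {A A' M M' : Tm C} (hA : EqvGen (Cong r) A A') (hM : EqvGen (Cong r) M M') :
    EqvGen (Cong r) (.lam A M) (.lam A' M') :=
  .trans _ _ _ (eqvGen_lift (fun X => Tm.lam X M) (fun _ _ h => .rel _ _ (.lamA h)) hA)
    (eqvGen_lift (fun X => Tm.lam A' X) (fun _ _ h => .rel _ _ (.lamM h)) hM)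

theorem eqvGen_pi {A A' B B' : Tm C} (hA : EqvGen (Cong r) A A') (hB : EqvGen (Cong r) B B') :
    EqvGen (Cong r) (.pi A B) (.pi A' B') :=
  .trans _ _ _ (eqvGen_lift (fun X => Tm.pi X B) (fun _ _ h => .rel _ _ (.piA h)) hA)
    (eqvGen_lift (fun X => Tm.pi A' X) (fun _ _ h => .rel _ _ (.piB h)) hB)

theorem eqvGen_const {c : C} {Ms Ns : List (Tm C)} (h : List.Forall₂ (EqvGen (Cong r)) Ms Ns) :
    EqvGen (Cong r) (.const c Ms) (.const c Ns) := by
  suffices H : ∀ l, EqvGen (Cong r) (.const c (l ++ Ms)) (.const c (l ++ Ns)) from H []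
  induction h with
  | nil => exact fun _ => .refl _
  | @cons M N Ms Ns h _ ih =>
    intro l
    refine .trans _ _ _ (eqvGen_lift (fun X => Tm.const c (l ++ X :: Ms))
      (fun _ _ h => .rel _ _ (.constArg h)) h) ?_
    simpa using ih (l ++ [N])

theorem reflTransGen_app {M M' N N' : Tm C} (hM : ReflTransGen (Cong r) M M')
    (hN : ReflTransGen (Cong r) N N') : ReflTransGen (Cong r) (.app M N) (.app M' N') :=
  (hM.lift (fun X => Tm.app X N) fun _ _ h => .appL h).trans
    (hN.lift (fun X => Tm.app M' X) fun _ _ h => .appR h)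

theorem reflTransGen_lam {A A' M M' : Tm C} (hA : ReflTransGen (Cong r) A A')
    (hM : ReflTransGen (Cong r) M M') : ReflTransGen (Cong r) (.lam A M) (.lam A' M') :=
  (hA.lift (fun X => Tm.lam X M) fun _ _ h => .lamA h).trans
    (hM.lift (fun X => Tm.lam A' X) fun _ _ h => .lamM h)

theorem reflTransGen_const {c : C} {Ms Ns : List (Tm C)}
    (h : List.Forall₂ (ReflTransGen (Cong r)) Ms Ns) :
    ReflTransGen (Cong r) (.const c Ms) (.const c Ns) := by
  suffices H : ∀ l, ReflTransGen (Cong r) (.const c (l ++ Ms)) (.const c (l ++ Ns)) from H []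
  induction h with
  | nil => exact fun _ => .refl
  | @cons M N Ms Ns h _ ih =>
    intro l
    refine (h.lift (fun X => Tm.const c (l ++ X :: Ms)) fun _ _ h => .constArg h).trans ?_
    simpa using ih (l ++ [N])

theorem Cong.sub (hr : ∀ M N σ, r M N → r (M.sub σ) (N.sub σ)) {M N : Tm C} (h : Cong r M N) :
    ∀ σ, Cong r (M.sub σ) (N.sub σ) := by
  induction h with
  | base h => exact fun σ => .base (hr _ _ σ h)
  | appL _ ih => intro σ; simpa using .appL (ih σ)
  | appR _ ih => intro σ; simpa using .appR (ih σ)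
  | lamA _ ih => intro σ; simpa using .lamA (ih σ)
  | lamM _ ih => intro σ; simpa using .lamM (ih _)
  | piA _ ih => intro σ; simpa using .piA (ih σ)
  | piB _ ih => intro σ; simpa using .piB (ih _)
  | constArg _ ih => intro σ; simpa using .constArg (ih σ)

theorem betaRoot_sub (M N : Tm C) (σ : Nat → Tm C) (h : BetaRoot M N) :
    BetaRoot (M.sub σ) (N.sub σ) := by
  obtain ⟨A, P, Q, rfl, rfl⟩ := h
  exact ⟨A.sub σ, P.sub (Tm.liftSub σ), Q.sub σ, by simp, Tm.sub_substAt_zero _ _ _⟩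

theorem ruleRoot_sub (R : Rules C) (M N : Tm C) (σ : Nat → Tm C) (h : RuleRoot R M N) :
    RuleRoot R (M.sub σ) (N.sub σ) := by
  obtain ⟨rl, hrl, τ, rfl, rfl⟩ := h
  exact ⟨rl, hrl, fun n => (τ n).sub σ, Tm.sub_sub _ _ _, Tm.sub_sub _ _ _⟩

theorem betas_ren {M N : Tm C} (h : ReflTransGen Beta M N) (ρ : Nat → Nat) :
    ReflTransGen Beta (M.ren ρ) (N.ren ρ) := by
  simp only [Tm.ren_eq_sub]
  exact h.lift (Tm.sub fun n => .var (ρ n)) fun _ _ h => Cong.sub betaRoot_sub h _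

variable {R : Rules C}

theorem Conv.refl (M : Tm C) : Conv R M M := EqvGen.refl _

theorem Conv.symm {M N : Tm C} (h : Conv R M N) : Conv R N M := EqvGen.symm _ _ h

theorem Conv.trans {M N P : Tm C} (h : Conv R M N) (h' : Conv R N P) : Conv R M P :=
  EqvGen.trans _ _ _ h h'

theorem Conv.sub {M N : Tm C} (h : Conv R M N) (σ : Nat → Tm C) :
    Conv R (M.sub σ) (N.sub σ) := by
  refine eqvGen_lift (fun X => Tm.sub σ X) (fun _ _ h => .rel _ _ (Cong.sub ?_ h _)) h
  rintro M N σ (h | h)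
  · exact .inl (betaRoot_sub _ _ _ h)
  · exact .inr (ruleRoot_sub _ _ _ _ h)

theorem Conv.ren {M N : Tm C} (h : Conv R M N) (ρ : Nat → Nat) :
    Conv R (M.ren ρ) (N.ren ρ) := by
  simpa only [Tm.ren_eq_sub] using h.sub _

theorem Cong.mono {r r' : Tm C → Tm C → Prop} (hr : ∀ M N, r M N → Cong r' M N) {M N : Tm C}
    (h : Cong r M N) : Cong r' M N := by
  induction h with
  | base h => exact hr _ _ h
  | appL _ ih => exact .appL ih
  | appR _ ih => exact .appR ih
  | lamA _ ih => exact .lamA ih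
  | lamM _ ih => exact .lamM ih
  | piA _ ih => exact .piA ih
  | piB _ ih => exact .piB ih
  | constArg _ ih => exact .constArg ih

theorem conv_of_betas {M N : Tm C} (h : ReflTransGen Beta M N) : Conv R M N := by
  induction h with
  | refl => exact .refl _
  | tail _ h ih => exact ih.trans (.rel _ _ (h.mono fun _ _ h => .base (.inl h)))

theorem conv_beta (A P Q : Tm C) : Conv R (.app (.lam A P) Q) (Tm.substAt 0 Q P) :=
  .rel _ _ (.base (.inl ⟨A, P, Q, rfl, rfl⟩))

end Congruence

theorem conv_Elcon {R : Rules (EConst S)} {s : S} {M N : Tm (EConst S)} (h : Conv R M N) :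
    Conv R (Elcon s M) (Elcon s N) :=
  eqvGen_const (.cons h .nil)

theorem HConv.conv {R : Rules (EConst S)} {M N : Tm (EConst S)} (h : HConv R M N) :
    Conv R M N := by
  refine eqvGen_lift id (fun _ _ h => .rel _ _ (h.mono ?_)) h
  rintro _ _ ⟨A, A', P, h, rfl, rfl⟩
  exact .lamA h

theorem HConv.lam_of_conv {R : Rules (EConst S)} {A A' M M' : Tm (EConst S)} (hA : Conv R A A')
    (hM : HConv R M M') : HConv R (.lam A M) (.lam A' M') := by
  have hM' : HConv R (.lam A' M) (.lam A' M') := eqvGen_lam (.refl _) hM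
  refine Relation.EqvGen.trans _ _ _ ?_ hM'
  exact eqvGen_lift (fun X => Tm.lam X M) (fun A A' h => .rel _ _ (.base ⟨A, A', M, h, rfl, rfl⟩)) hA

/-! ## Confluence of `𝓡_EPTS` together with β -/

section Confluence

open Relation

variable {Ar : S → S → Prop} {Rr : S → S → S → Prop}

/-- Parallel reduction for β and `𝓡_EPTS`. -/
inductive Par (Ar : S → S → Prop) (Rr : S → S → S → Prop) :
    Tm (EConst S) → Tm (EConst S) → Prop
  | var (n) : Par Ar Rr (.var n) (.var n)
  | type : Par Ar Rr .type .type
  | kind : Par Ar Rr .kind .kind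
  | app {M M' N N'} : Par Ar Rr M M' → Par Ar Rr N N' → Par Ar Rr (.app M N) (.app M' N')
  | lam {A A' M M'} : Par Ar Rr A A' → Par Ar Rr M M' → Par Ar Rr (.lam A M) (.lam A' M')
  | pi {A A' B B'} : Par Ar Rr A A' → Par Ar Rr B B' → Par Ar Rr (.pi A B) (.pi A' B')
  | const {c} {Ms Ns : List (Tm (EConst S))} : Ms.length = Ns.length →
      (∀ i (h₁ : i < Ms.length) (h₂ : i < Ns.length), Par Ar Rr (Ms.get ⟨i, h₁⟩) (Ns.get ⟨i, h₂⟩)) →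
      Par Ar Rr (.const c Ms) (.const c Ns)
  | beta {A P P' Q Q'} : Par Ar Rr P P' → Par Ar Rr Q Q' →
      Par Ar Rr (.app (.lam A P) Q) (Tm.substAt 0 Q' P')
  | elU {s₁ s₂} : Ar s₁ s₂ →
      Par Ar Rr (.const (.El s₂) [.const (.u s₁) []]) (.const (.U s₁) [])
  | appAbs {s₁ s₂ s₃ A B A' B' M M' N N'} : Rr s₁ s₂ s₃ → Par Ar Rr M M' → Par Ar Rr N N' →
      Par Ar Rr (.const (.app s₁ s₂) [A, B, .const (.abs s₁ s₂) [A', B', M], N]) (.app M' N')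

theorem Par.of_forall₂ {c : EConst S} {Ms Ns : List (Tm (EConst S))}
    (h : List.Forall₂ (Par Ar Rr) Ms Ns) : Par Ar Rr (.const c Ms) (.const c Ns) :=
  have h := List.forall₂_iff_get.1 h
  .const h.1 h.2

theorem Par.refl (M : Tm (EConst S)) : Par Ar Rr M M := by
  induction M using Tm.ind with
  | var => exact .var _
  | const c Ms ih => exact .of_forall₂ (List.forall₂_same.2 ih)
  | type => exact .type
  | kind => exact .kind
  | app _ _ h₁ h₂ => exact .app h₁ h₂
  | lam _ _ h₁ h₂ => exact .lam h₁ h₂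
  | pi _ _ h₁ h₂ => exact .pi h₁ h₂

theorem Par.ren {M N : Tm (EConst S)} (h : Par Ar Rr M N) :
    ∀ ρ, Par Ar Rr (M.ren ρ) (N.ren ρ) := by
  induction h with
  | const hl _ ih =>
    intro ρ
    simp only [Tm.ren_const]
    exact .const (by simpa using hl) fun i h₁ h₂ => by
      simpa using ih i (by simpa using h₁) (by simpa using h₂) ρ
  | beta _ _ ih₁ ih₂ =>
    intro ρ
    rw [Tm.ren_eq_sub (Tm.substAt _ _ _), Tm.sub_substAt_zero, Tm.liftSub_var]
    simpa [Tm.ren_eq_sub, Tm.liftSub_var] using Par.beta (A := Tm.ren ρ _) (ih₁ (Tm.liftRen ρ)) (ih₂ ρ)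
  | elU h => intro ρ; simpa using .elU h
  | appAbs h _ _ ih₁ ih₂ => intro ρ; simpa using .appAbs h (ih₁ ρ) (ih₂ ρ)
  | app _ _ ih₁ ih₂ => intro ρ; simpa using .app (ih₁ ρ) (ih₂ ρ)
  | lam _ _ ih₁ ih₂ => intro ρ; simpa using .lam (ih₁ ρ) (ih₂ _)
  | pi _ _ ih₁ ih₂ => intro ρ; simpa using .pi (ih₁ ρ) (ih₂ _)
  | _ => exact fun _ => .refl _

theorem Par.sub {M N : Tm (EConst S)} (h : Par Ar Rr M N) :
    ∀ {σ τ}, (∀ n, Par Ar Rr (σ n) (τ n)) → Par Ar Rr (M.sub σ) (N.sub τ) := by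
  have lift : ∀ {σ τ : Nat → Tm (EConst S)}, (∀ n, Par Ar Rr (σ n) (τ n)) →
      ∀ n, Par Ar Rr (Tm.liftSub σ n) (Tm.liftSub τ n) := by
    intro σ τ h n
    cases n
    · exact .refl _
    · exact (h _).ren _
  induction h with
  | var n => intro σ τ hσ; simpa using hσ n
  | const hl _ ih =>
    intro σ τ hσ
    simp only [Tm.sub_const]
    exact .const (by simpa using hl) fun i h₁ h₂ => by
      simpa using ih i (by simpa using h₁) (by simpa using h₂) hσ
  | beta _ _ ih₁ ih₂ =>
    intro σ τ hσ
    rw [Tm.sub_substAt_zero]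
    simpa using Par.beta (A := Tm.sub σ _) (ih₁ (lift hσ)) (ih₂ hσ)
  | elU h => intro σ τ hσ; simpa using .elU h
  | appAbs h _ _ ih₁ ih₂ => intro σ τ hσ; simpa using .appAbs h (ih₁ hσ) (ih₂ hσ)
  | app _ _ ih₁ ih₂ => intro σ τ hσ; simpa using .app (ih₁ hσ) (ih₂ hσ)
  | lam _ _ ih₁ ih₂ => intro σ τ hσ; simpa using .lam (ih₁ hσ) (ih₂ (lift hσ))
  | pi _ _ ih₁ ih₂ => intro σ τ hσ; simpa using .pi (ih₁ hσ) (ih₂ (lift hσ))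
  | type => intro σ τ _; simpa using .type
  | kind => intro σ τ _; simpa using .kind

theorem Par.substAt_zero {M M' N N' : Tm (EConst S)} (hM : Par Ar Rr M M') (hN : Par Ar Rr N N') :
    Par Ar Rr (Tm.substAt 0 N M) (Tm.substAt 0 N' M') := by
  rw [Tm.substAt_zero, Tm.substAt_zero]
  refine hM.sub fun n => ?_
  cases n
  · exact hN
  · exact .refl _

theorem Par.const_inv {c : EConst S} {Ms : List (Tm (EConst S))} {N : Tm (EConst S)}
    (h : Par Ar Rr (.const c Ms) N) :
    (∃ Ns, N = .const c Ns ∧ List.Forall₂ (Par Ar Rr) Ms Ns) ∨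
    (∃ s₁ s₂, Ar s₁ s₂ ∧ c = .El s₂ ∧ Ms = [.const (.u s₁) []] ∧ N = .const (.U s₁) []) ∨
    (∃ s₁ s₂ s₃ A B A' B' P P' Q Q', Rr s₁ s₂ s₃ ∧ c = .app s₁ s₂ ∧
      Ms = [A, B, .const (.abs s₁ s₂) [A', B', P], Q] ∧ N = .app P' Q' ∧
      Par Ar Rr P P' ∧ Par Ar Rr Q Q') := by
  cases h with
  | const hl h => exact .inl ⟨_, rfl, List.forall₂_iff_get.2 ⟨hl, h⟩⟩
  | elU h => exact .inr (.inl ⟨_, _, h, rfl, rfl, rfl⟩)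
  | appAbs h h₁ h₂ =>
    exact .inr (.inr ⟨_, _, _, _, _, _, _, _, _, _, _, h, rfl, rfl, rfl, h₁, h₂⟩)

theorem Par.abs_inv {s₁ s₂ : S} {A B M N : Tm (EConst S)}
    (h : Par Ar Rr (.const (.abs s₁ s₂) [A, B, M]) N) :
    ∃ A' B' M', N = .const (.abs s₁ s₂) [A', B', M'] ∧ Par Ar Rr A A' ∧ Par Ar Rr B B' ∧
      Par Ar Rr M M' := by
  rcases h.const_inv with ⟨Ns, rfl, hs⟩ | ⟨_, _, _, hc, _⟩ |
    ⟨_, _, _, _, _, _, _, _, _, _, _, _, hc, _⟩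
  · simp only [List.forall₂_cons_left_iff, List.forall₂_nil_left_iff] at hs
    obtain ⟨A', _, hA, ⟨B', _, hB, ⟨M', _, hM, rfl, rfl⟩, rfl⟩, rfl⟩ := hs
    exact ⟨A', B', M', rfl, hA, hB, hM⟩
  · cases hc
  · cases hc

theorem Par.lam_inv {A M N : Tm (EConst S)} (h : Par Ar Rr (.lam A M) N) :
    ∃ A' M', N = .lam A' M' ∧ Par Ar Rr A A' ∧ Par Ar Rr M M' := by
  cases h with
  | lam h₁ h₂ => exact ⟨_, _, rfl, h₁, h₂⟩

theorem forall₂_diamond {α : Type} {r : α → α → Prop} {l l₁ l₂ : List α}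
    (h₁ : List.Forall₂ (fun a b => ∀ c, r a c → ∃ d, r b d ∧ r c d) l l₁)
    (h₂ : List.Forall₂ r l l₂) : ∃ l₃, List.Forall₂ r l₁ l₃ ∧ List.Forall₂ r l₂ l₃ := by
  induction h₁ generalizing l₂ with
  | nil => cases h₂; exact ⟨[], .nil, .nil⟩
  | cons h _ ih =>
    cases h₂ with
    | cons h' hs =>
      obtain ⟨d, h₁, h₂⟩ := h _ h'
      obtain ⟨ds, hs₁, hs₂⟩ := ih hs
      exact ⟨d :: ds, .cons h₁ hs₁, .cons h₂ hs₂⟩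

theorem Par.diamond {M N₁ : Tm (EConst S)} (h₁ : Par Ar Rr M N₁) :
    ∀ N₂, Par Ar Rr M N₂ → ∃ N, Par Ar Rr N₁ N ∧ Par Ar Rr N₂ N := by
  induction h₁ with
  | var => intro _ h; exact ⟨_, h, .refl _⟩
  | type => intro _ h; exact ⟨_, h, .refl _⟩
  | kind => intro _ h; exact ⟨_, h, .refl _⟩
  | lam _ _ ih₁ ih₂ =>
    intro _ h
    obtain ⟨A, M, rfl, hA, hM⟩ := h.lam_inv
    obtain ⟨A', h₁, h₂⟩ := ih₁ _ hA
    obtain ⟨M', h₃, h₄⟩ := ih₂ _ hM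
    exact ⟨_, .lam h₁ h₃, .lam h₂ h₄⟩
  | pi _ _ ih₁ ih₂ =>
    intro _ h
    cases h with
    | pi hA hB =>
      obtain ⟨A', h₁, h₂⟩ := ih₁ _ hA
      obtain ⟨M', h₃, h₄⟩ := ih₂ _ hB
      exact ⟨_, .pi h₁ h₃, .pi h₂ h₄⟩
  | app hM hN ih₁ ih₂ =>
    intro _ h
    cases h with
    | app hA hB =>
      obtain ⟨A', h₁, h₂⟩ := ih₁ _ hA
      obtain ⟨M', h₃, h₄⟩ := ih₂ _ hB
      exact ⟨_, .app h₁ h₃, .app h₂ h₄⟩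
    | beta hP hQ =>
      obtain ⟨A₁, P₁, rfl, -, -⟩ := hM.lam_inv
      obtain ⟨D, h₁, h₂⟩ := ih₁ _ (.lam (.refl _) hP)
      obtain ⟨A₃, P₃, rfl, -, h₁⟩ := h₁.lam_inv
      cases h₂ with
      | lam _ h₂ =>
        obtain ⟨Q₃, h₃, h₄⟩ := ih₂ _ hQ
        exact ⟨_, .beta h₁ h₃, h₂.substAt_zero h₄⟩
  | beta _ _ ih₁ ih₂ =>
    intro _ h
    cases h with
    | app hM hN =>
      obtain ⟨A₁, P₁, rfl, -, hP⟩ := hM.lam_inv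
      obtain ⟨P₃, h₁, h₂⟩ := ih₁ _ hP
      obtain ⟨Q₃, h₃, h₄⟩ := ih₂ _ hN
      exact ⟨_, h₁.substAt_zero h₃, .beta h₂ h₄⟩
    | beta hP hQ =>
      obtain ⟨P₃, h₁, h₂⟩ := ih₁ _ hP
      obtain ⟨Q₃, h₃, h₄⟩ := ih₂ _ hQ
      exact ⟨_, h₁.substAt_zero h₃, h₂.substAt_zero h₄⟩
  | elU h =>
    intro _ h'
    rcases h'.const_inv with ⟨Ns, rfl, hs⟩ | ⟨s₁, s₂, _, hc, hl, rfl⟩ |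
      ⟨_, _, _, _, _, _, _, _, _, _, _, _, hc, _⟩
    · simp only [List.forall₂_cons_left_iff, List.forall₂_nil_left_iff] at hs
      obtain ⟨X, _, hX, rfl, rfl⟩ := hs
      rcases hX.const_inv with ⟨Ns, rfl, hs⟩ | ⟨_, _, _, hc, _⟩ |
        ⟨_, _, _, _, _, _, _, _, _, _, _, _, hc, _⟩
      · cases hs
        exact ⟨_, .refl _, .elU h⟩
      · cases hc
      · cases hc
    · cases hl
      exact ⟨_, .refl _, .refl _⟩
    · cases hc
  | appAbs h _ _ ih₁ ih₂ =>
    intro _ h'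
    rcases h'.const_inv with ⟨Ns, rfl, hs⟩ | ⟨_, _, _, hc, _⟩ |
      ⟨_, _, _, _, _, _, _, _, P', _, Q', _, hc, hl, rfl, hP, hQ⟩
    · simp only [List.forall₂_cons_left_iff, List.forall₂_nil_left_iff] at hs
      obtain ⟨A, _, -, ⟨B, _, -, ⟨X, _, hX, ⟨Y, _, hY, rfl, rfl⟩, rfl⟩, rfl⟩, rfl⟩ := hs
      obtain ⟨A', B', M', rfl, -, -, hM⟩ := hX.abs_inv
      obtain ⟨P₃, h₁, h₂⟩ := ih₁ _ hM
      obtain ⟨Q₃, h₃, h₄⟩ := ih₂ _ hY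
      exact ⟨_, .app h₁ h₃, .appAbs h h₂ h₄⟩
    · cases hc
    · cases hl
      obtain ⟨P₃, h₁, h₂⟩ := ih₁ _ hP
      obtain ⟨Q₃, h₃, h₄⟩ := ih₂ _ hQ
      exact ⟨_, .app h₁ h₃, .app h₂ h₄⟩
  | const hl hp ih =>
    intro _ h'
    have hs' := List.forall₂_iff_get.2 ⟨hl, hp⟩
    have ih := (List.forall₂_iff_get
      (R := fun M N => ∀ M', Par Ar Rr M M' → ∃ N', Par Ar Rr N N' ∧ Par Ar Rr M' N')).2 ⟨hl, ih⟩
    rcases h'.const_inv with ⟨Ns, rfl, hs⟩ | ⟨_, _, h, rfl, rfl, rfl⟩ |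
      ⟨_, _, _, _, _, _, _, _, P', _, Q', h, rfl, rfl, rfl, hP, hQ⟩
    · obtain ⟨Ds, h₁, h₂⟩ := forall₂_diamond ih hs
      exact ⟨_, .of_forall₂ h₁, .of_forall₂ h₂⟩
    · simp only [List.forall₂_cons_left_iff, List.forall₂_nil_left_iff] at hs'
      obtain ⟨X, _, hX, rfl, rfl⟩ := hs'
      rcases hX.const_inv with ⟨Ns, rfl, hs⟩ | ⟨_, _, _, hc, _⟩ |
        ⟨_, _, _, _, _, _, _, _, _, _, _, _, hc, _⟩
      · cases hs
        exact ⟨_, .elU h, .refl _⟩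
      · cases hc
      · cases hc
    · simp only [List.forall₂_cons_left_iff, List.forall₂_nil_left_iff] at hs'
      obtain ⟨A, _, -, ⟨B, _, -, ⟨X, _, hX, ⟨Y, _, hY, rfl, rfl⟩, rfl⟩, rfl⟩, rfl⟩ := hs'
      simp only [List.forall₂_cons, List.Forall₂.nil, and_true] at ih
      obtain ⟨D, hD₁, hD₂⟩ := ih.2.2.1 _
        (.of_forall₂ (.cons (.refl _) (.cons (.refl _) (.cons hP .nil))))
      obtain ⟨Q₃, h₃, h₄⟩ := ih.2.2.2 _ hQ
      obtain ⟨A', B', M', rfl, -, -, hM⟩ := hX.abs_inv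
      obtain ⟨A₂, B₂, M₂, rfl, -, -, hM₂⟩ := hD₁.abs_inv
      obtain ⟨_, _, _, heq, -, -, hM₃⟩ := hD₂.abs_inv
      cases heq
      exact ⟨_, .appAbs h hM₂ h₃, .app hM₃ h₄⟩

theorem Par.of_step {M N : Tm (EConst S)} (h : Step (rulesEPTS Ar Rr) M N) : Par Ar Rr M N := by
  induction h with
  | base h =>
    rcases h with ⟨A, P, Q, rfl, rfl⟩ | ⟨rl, hrl | hrl, σ, rfl, rfl⟩
    · exact .beta (.refl _) (.refl _)
    · cases hrl with
      | u_red h => simpa [ucon, Ucon] using Par.elU h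
    · cases hrl with
      | beta h => simpa [absC] using Par.appAbs h (.refl _) (.refl _)
  | appL _ ih => exact .app ih (.refl _)
  | appR _ ih => exact .app (.refl _) ih
  | lamA _ ih => exact .lam ih (.refl _)
  | lamM _ ih => exact .lam (.refl _) ih
  | piA _ ih => exact .pi ih (.refl _)
  | piB _ ih => exact .pi (.refl _) ih
  | constArg _ ih =>
    exact .of_forall₂ (List.rel_append (List.forall₂_same.2 fun _ _ => .refl _)
      (.cons ih (List.forall₂_same.2 fun _ _ => .refl _)))

theorem Par.conv {M N : Tm (EConst S)} (h : Par Ar Rr M N) : Conv (rulesEPTS Ar Rr) M N := by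
  induction h with
  | app _ _ ih₁ ih₂ => exact eqvGen_app ih₁ ih₂
  | lam _ _ ih₁ ih₂ => exact eqvGen_lam ih₁ ih₂
  | pi _ _ ih₁ ih₂ => exact eqvGen_pi ih₁ ih₂
  | const hl _ ih => exact eqvGen_const (List.forall₂_iff_get.2 ⟨hl, ih⟩)
  | @beta A P P' Q Q' _ _ ih₁ ih₂ =>
    exact .trans (eqvGen_app (eqvGen_lam (.refl A) ih₁) ih₂) (conv_beta _ _ _)
  | elU h =>
    exact .rel _ _ (.base (.inr ⟨_, .inl (.u_red h), Tm.var, by simp [ucon], by simp [Ucon]⟩))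
  | @appAbs s₁ s₂ s₃ A B A' B' M M' N N' h _ _ ih₁ ih₂ =>
    refine .trans (.rel _ _ (.base (.inr ⟨_, .inr (.beta h),
      scons A (scons B (scons A' (scons B' (scons M (scons N Tm.var))))), ?_, rfl⟩))) ?_
    · simp [absC, scons]
    · simp only [Tm.sub.eq_5, Tm.sub.eq_1]
      exact eqvGen_app ih₁ ih₂
  | _ => exact .refl _

theorem pars_conv {M N : Tm (EConst S)} (h : ReflTransGen (Par Ar Rr) M N) :
    Conv (rulesEPTS Ar Rr) M N := by
  induction h with
  | refl => exact .refl _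
  | tail _ h ih => exact ih.trans h.conv

theorem Conv.join {M N : Tm (EConst S)} (h : Conv (rulesEPTS Ar Rr) M N) :
    ∃ W, ReflTransGen (Par Ar Rr) M W ∧ ReflTransGen (Par Ar Rr) N W := by
  have hequiv : Equivalence (Join (ReflTransGen (Par Ar Rr))) :=
    equivalence_join_reflTransGen fun a b c h₁ h₂ =>
      have ⟨d, h₃, h₄⟩ := h₁.diamond _ h₂
      ⟨d, .single h₃, .single h₄⟩
  refine (hequiv.eqvGen_iff).1 (h.mono fun a b h => ?_)
  exact ⟨b, .single (.of_step h), .refl⟩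

end Confluence

/-! ## Inversion of conversions between types -/

section Inversion

open Relation

variable {Ar : S → S → Prop} {Rr : S → S → S → Prop}

theorem pars_pi_inv {A B W : Tm (EConst S)} (h : ReflTransGen (Par Ar Rr) (.pi A B) W) :
    ∃ A' B', W = .pi A' B' ∧ ReflTransGen (Par Ar Rr) A A' ∧ ReflTransGen (Par Ar Rr) B B' := by
  induction h with
  | refl => exact ⟨A, B, rfl, .refl, .refl⟩
  | tail _ h ih =>
    obtain ⟨A', B', rfl, hA, hB⟩ := ih
    cases h with
    | pi h₁ h₂ => exact ⟨_, _, rfl, hA.tail h₁, hB.tail h₂⟩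

theorem pars_type_inv {W : Tm (EConst S)} (h : ReflTransGen (Par Ar Rr) .type W) : W = .type := by
  induction h with
  | refl => rfl
  | tail _ h ih =>
    subst ih
    cases h
    rfl

theorem pars_kind_inv {W : Tm (EConst S)} (h : ReflTransGen (Par Ar Rr) .kind W) : W = .kind := by
  induction h with
  | refl => rfl
  | tail _ h ih =>
    subst ih
    cases h
    rfl

theorem Par.Ucon_inv {s : S} {W : Tm (EConst S)} (h : Par Ar Rr (Ucon s) W) : W = Ucon s := by
  rcases h.const_inv with ⟨Ns, rfl, hs⟩ | ⟨_, _, _, hc, _⟩ |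
    ⟨_, _, _, _, _, _, _, _, _, _, _, _, hc, _⟩
  · cases hs
    rfl
  · cases hc
  · cases hc

theorem Par.Elcon_inv {s : S} {M W : Tm (EConst S)} (h : Par Ar Rr (Elcon s M) W) :
    (∃ M', W = Elcon s M' ∧ Par Ar Rr M M') ∨ ∃ s', Ar s' s ∧ M = ucon s' ∧ W = Ucon s' := by
  rcases h.const_inv with ⟨Ns, rfl, hs⟩ | ⟨_, _, ha, hc, hl, rfl⟩ |
    ⟨_, _, _, _, _, _, _, _, _, _, _, _, hc, _⟩
  · simp only [List.forall₂_cons_left_iff, List.forall₂_nil_left_iff] at hs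
    obtain ⟨M', _, hM, rfl, rfl⟩ := hs
    exact .inl ⟨M', rfl, hM⟩
  · cases hc
    cases hl
    exact .inr ⟨_, ha, rfl, rfl⟩
  · cases hc

theorem pars_Ucon_inv {s : S} {W : Tm (EConst S)} (h : ReflTransGen (Par Ar Rr) (Ucon s) W) :
    W = Ucon s := by
  induction h with
  | refl => rfl
  | tail _ h ih =>
    subst ih
    exact h.Ucon_inv

theorem pars_Elcon_inv {s : S} {M W : Tm (EConst S)}
    (h : ReflTransGen (Par Ar Rr) (Elcon s M) W) :
    (∃ M', W = Elcon s M' ∧ ReflTransGen (Par Ar Rr) M M') ∨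
      ∃ s', Ar s' s ∧ ReflTransGen (Par Ar Rr) M (ucon s') ∧ W = Ucon s' := by
  induction h with
  | refl => exact .inl ⟨M, rfl, .refl⟩
  | tail _ h ih =>
    rcases ih with ⟨M', rfl, hM⟩ | ⟨s', hs, hM, rfl⟩
    · rcases h.Elcon_inv with ⟨M'', rfl, hM'⟩ | ⟨s', hs, rfl, rfl⟩
      · exact .inl ⟨M'', rfl, hM.tail hM'⟩
      · exact .inr ⟨s', hs, hM, rfl⟩
    · exact .inr ⟨s', hs, hM, h.Ucon_inv⟩

theorem conv_pi_inj {A B A' B' : Tm (EConst S)}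
    (h : Conv (rulesEPTS Ar Rr) (.pi A B) (.pi A' B')) :
    Conv (rulesEPTS Ar Rr) A A' ∧ Conv (rulesEPTS Ar Rr) B B' := by
  obtain ⟨W, h₁, h₂⟩ := h.join
  obtain ⟨A₁, B₁, rfl, hA₁, hB₁⟩ := pars_pi_inv h₁
  obtain ⟨A₂, B₂, heq, hA₂, hB₂⟩ := pars_pi_inv h₂
  cases heq
  exact ⟨(pars_conv hA₁).trans (pars_conv hA₂).symm, (pars_conv hB₁).trans (pars_conv hB₂).symm⟩

theorem not_conv_type_Ucon {s : S} : ¬ Conv (rulesEPTS Ar Rr) .type (Ucon s) := by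
  intro h
  obtain ⟨W, h₁, h₂⟩ := h.join
  cases (pars_type_inv h₁).symm.trans (pars_Ucon_inv h₂)

theorem not_conv_type_Elcon {s : S} {M : Tm (EConst S)} :
    ¬ Conv (rulesEPTS Ar Rr) .type (Elcon s M) := by
  intro h
  obtain ⟨W, h₁, h₂⟩ := h.join
  obtain rfl := pars_type_inv h₁
  rcases pars_Elcon_inv h₂ with ⟨_, h, _⟩ | ⟨_, _, _, h⟩ <;> cases h

theorem not_conv_pi_Elcon {s : S} {A B M : Tm (EConst S)} :
    ¬ Conv (rulesEPTS Ar Rr) (.pi A B) (Elcon s M) := by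
  intro h
  obtain ⟨W, h₁, h₂⟩ := h.join
  obtain ⟨A', B', rfl, -, -⟩ := pars_pi_inv h₁
  rcases pars_Elcon_inv h₂ with ⟨_, h, _⟩ | ⟨_, _, _, h⟩ <;> cases h

theorem conv_Ucon_inj {s s' : S} (h : Conv (rulesEPTS Ar Rr) (Ucon s) (Ucon s')) : s = s' := by
  obtain ⟨W, h₁, h₂⟩ := h.join
  cases (pars_Ucon_inv h₁).symm.trans (pars_Ucon_inv h₂)
  rfl

theorem conv_Ucon_Elcon {s s' : S} {M : Tm (EConst S)}
    (h : Conv (rulesEPTS Ar Rr) (Ucon s) (Elcon s' M)) :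
    Ar s s' ∧ Conv (rulesEPTS Ar Rr) M (ucon s) := by
  obtain ⟨W, h₁, h₂⟩ := h.join
  obtain rfl := pars_Ucon_inv h₁
  rcases pars_Elcon_inv h₂ with ⟨_, h, _⟩ | ⟨_, ha, hM, h⟩ <;> cases h
  exact ⟨ha, pars_conv hM⟩

theorem conv_Elcon_Elcon {s s' : S} {M M' : Tm (EConst S)}
    (h : Conv (rulesEPTS Ar Rr) (Elcon s M) (Elcon s' M')) : Conv (rulesEPTS Ar Rr) M M' := by
  obtain ⟨W, h₁, h₂⟩ := h.join
  rcases pars_Elcon_inv h₁ with ⟨_, rfl, hM⟩ | ⟨_, ha, hM, rfl⟩ <;>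
    rcases pars_Elcon_inv h₂ with ⟨_, h, hM'⟩ | ⟨_, ha', hM', h⟩ <;> cases h <;>
    exact (pars_conv hM).trans (pars_conv hM').symm

end Inversion

/-! ## Conversion in the EPTS -/

section EConversion

open Relation

variable {Rr : S → S → S → Prop}

theorem EConv.symm {M N : ETm S} (h : EConv Rr M N) : EConv Rr N M := EqvGen.symm _ _ h

theorem EConv.trans {M N P : ETm S} (h : EConv Rr M N) (h' : EConv Rr N P) : EConv Rr M P :=
  EqvGen.trans _ _ _ h h'

theorem EConv.congr (f : ETm S → ETm S) (hf : ∀ M N, EStep Rr M N → EStep Rr (f M) (f N))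
    {M N : ETm S} (h : EConv Rr M N) : EConv Rr (f M) (f N) :=
  eqvGen_lift f (fun M N h => EqvGen.rel _ _ (hf M N h)) h

theorem EConv.pi {s₁ s₂ : S} {A A' B B' : ETm S} (hA : EConv Rr A A') (hB : EConv Rr B B') :
    EConv Rr (.pi s₁ s₂ A B) (.pi s₁ s₂ A' B') :=
  (hA.congr (fun X => .pi s₁ s₂ X B) fun _ _ => ECong.piA).trans
    (hB.congr (fun X => .pi s₁ s₂ A' X) fun _ _ => ECong.piB)

theorem EConv.lam {s₁ s₂ : S} {A A' B B' M M' : ETm S} (hA : EConv Rr A A')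
    (hB : EConv Rr B B') (hM : EConv Rr M M') :
    EConv Rr (.lam s₁ s₂ A B M) (.lam s₁ s₂ A' B' M') :=
  (hA.congr (fun X => .lam s₁ s₂ X B M) fun _ _ => ECong.lamA).trans
    ((hB.congr (fun X => .lam s₁ s₂ A' X M) fun _ _ => ECong.lamB).trans
      (hM.congr (fun X => .lam s₁ s₂ A' B' X) fun _ _ => ECong.lamM))

theorem EConv.app {s₁ s₂ : S} {A A' B B' M M' N N' : ETm S} (hA : EConv Rr A A')
    (hB : EConv Rr B B') (hM : EConv Rr M M') (hN : EConv Rr N N') :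
    EConv Rr (.app s₁ s₂ A B M N) (.app s₁ s₂ A' B' M' N') :=
  (hA.congr (fun X => .app s₁ s₂ X B M N) fun _ _ => ECong.appA).trans
    ((hB.congr (fun X => .app s₁ s₂ A' X M N) fun _ _ => ECong.appB).trans
      ((hM.congr (fun X => .app s₁ s₂ A' B' X N) fun _ _ => ECong.appM).trans
        (hN.congr (fun X => .app s₁ s₂ A' B' M' X) fun _ _ => ECong.appN)))

theorem EStep.sub {M N : ETm S} (h : EStep Rr M N) : ∀ σ, EStep Rr (M.sub σ) (N.sub σ) := by
  induction h with
  | base h =>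
    intro σ
    obtain ⟨s₁, s₂, s₃, A, B, A', B', P, Q, hr, rfl, rfl⟩ := h
    exact .base ⟨s₁, s₂, s₃, _, _, _, _, _, _, hr, rfl, ETm.sub_substAt_zero _ _ _⟩
  | piA _ ih => exact fun σ => .piA (ih _)
  | piB _ ih => exact fun σ => .piB (ih _)
  | lamA _ ih => exact fun σ => .lamA (ih _)
  | lamB _ ih => exact fun σ => .lamB (ih _)
  | lamM _ ih => exact fun σ => .lamM (ih _)
  | appA _ ih => exact fun σ => .appA (ih _)
  | appB _ ih => exact fun σ => .appB (ih _)
  | appM _ ih => exact fun σ => .appM (ih _)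
  | appN _ ih => exact fun σ => .appN (ih _)

theorem EConv.sub {M N : ETm S} (h : EConv Rr M N) (σ : Nat → ETm S) :
    EConv Rr (M.sub σ) (N.sub σ) :=
  h.congr (ETm.sub σ) fun _ _ h => h.sub σ

theorem EConv.ren {M N : ETm S} (h : EConv Rr M N) (ρ : Nat → Nat) :
    EConv Rr (M.ren ρ) (N.ren ρ) := by
  simpa only [ETm.ren_eq_sub] using h.sub _

theorem EConv.sub_right (M : ETm S) : ∀ {σ τ : Nat → ETm S}, (∀ n, EConv Rr (σ n) (τ n)) →
    EConv Rr (M.sub σ) (M.sub τ) := by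
  have lift : ∀ {σ τ : Nat → ETm S}, (∀ n, EConv Rr (σ n) (τ n)) →
      ∀ n, EConv Rr (ETm.liftSub σ n) (ETm.liftSub τ n) := by
    intro σ τ h n
    cases n
    · exact .refl _
    · exact (h _).ren _
  induction M with
  | var n => exact fun h => h n
  | sort s => exact fun _ => .refl _
  | pi _ _ _ _ ih₁ ih₂ => exact fun h => .pi (ih₁ h) (ih₂ (lift h))
  | lam _ _ _ _ _ ih₁ ih₂ ih₃ => exact fun h => .lam (ih₁ h) (ih₂ (lift h)) (ih₃ (lift h))
  | app _ _ _ _ _ _ ih₁ ih₂ ih₃ ih₄ =>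
    exact fun h => .app (ih₁ h) (ih₂ (lift h)) (ih₃ h) (ih₄ h)

theorem EConv.substAt_zero {M M' N N' : ETm S} (hM : EConv Rr M M') (hN : EConv Rr N N') :
    EConv Rr (ETm.substAt 0 N M) (ETm.substAt 0 N' M') := by
  rw [ETm.substAt_zero, ETm.substAt_zero]
  refine (hM.sub _).trans (EConv.sub_right _ fun n => ?_)
  cases n
  · exact hN
  · exact .refl _

end EConversion

/-! ## The inverse translation as a relation, and conservativity of conversion -/

section InverseTranslation

open Relation

variable {Ar : S → S → Prop} {Rr : S → S → S → Prop}

/-- `InvRel W M`: the term `W` is an invertible form whose inverse translation is `M`. -/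
inductive InvRel : Tm (EConst S) → ETm S → Prop
  | var (n) : InvRel (.var n) (.var n)
  | u (s) : InvRel (ucon s) (.sort s)
  | beta {T M M' N N'} : InvRel M M' → InvRel N N' →
      InvRel (.app (.lam T M) N) (ETm.substAt 0 N' M')
  | prod {s₁ s₂ A A' T B B'} : InvRel A A' → InvRel B B' →
      InvRel (ProdC s₁ s₂ A (.lam T B)) (.pi s₁ s₂ A' B')
  | abs {s₁ s₂ A A' T B B' U M M'} : InvRel A A' → InvRel B B' → InvRel M M' →
      InvRel (absC s₁ s₂ A (.lam T B) (.lam U M)) (.lam s₁ s₂ A' B' M')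
  | app {s₁ s₂ A A' T B B' M M' N N'} : InvRel A A' → InvRel B B' → InvRel M M' → InvRel N N' →
      InvRel (appC s₁ s₂ A (.lam T B) M N) (.app s₁ s₂ A' B' M' N')

theorem InvRel.trans (M : ETm S) : InvRel (trans M) M := by
  induction M with
  | var => exact .var _
  | sort => exact .u _
  | pi _ _ _ _ ih₁ ih₂ => exact .prod ih₁ ih₂
  | lam _ _ _ _ _ ih₁ ih₂ ih₃ => exact .abs ih₁ ih₂ ih₃
  | app _ _ _ _ _ _ ih₁ ih₂ ih₃ ih₄ => exact .app ih₁ ih₂ ih₃ ih₄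

theorem InvRel.unique {W : Tm (EConst S)} {M : ETm S} (h : InvRel W M) :
    ∀ {N}, InvRel W N → M = N := by
  induction h with
  | var => intro _ h; cases h; rfl
  | u => intro _ h; cases h; rfl
  | beta _ _ ih₁ ih₂ =>
    intro _ h
    cases h with
    | beta h₁ h₂ => rw [ih₁ h₁, ih₂ h₂]
  | prod _ _ ih₁ ih₂ =>
    intro _ h
    cases h with
    | prod h₁ h₂ => rw [ih₁ h₁, ih₂ h₂]
  | abs _ _ _ ih₁ ih₂ ih₃ =>
    intro _ h
    cases h with
    | abs h₁ h₂ h₃ => rw [ih₁ h₁, ih₂ h₂, ih₃ h₃]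
  | app _ _ _ _ ih₁ ih₂ ih₃ ih₄ =>
    intro _ h
    cases h with
    | app h₁ h₂ h₃ h₄ => rw [ih₁ h₁, ih₂ h₂, ih₃ h₃, ih₄ h₄]

theorem InvRel.ren {W : Tm (EConst S)} {M : ETm S} (h : InvRel W M) :
    ∀ ρ, InvRel (W.ren ρ) (M.ren ρ) := by
  induction h with
  | var n => intro ρ; simpa using .var _
  | u s => intro ρ; simpa [ucon] using .u s
  | beta _ _ ih₁ ih₂ =>
    intro ρ
    rw [ETm.ren_eq_sub (ETm.substAt _ _ _), ETm.sub_substAt_zero, ETm.liftSub_var,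
      ← ETm.ren_eq_sub, ← ETm.ren_eq_sub]
    simpa using .beta (ih₁ _) (ih₂ ρ)
  | prod _ _ ih₁ ih₂ =>
    intro ρ
    simpa [ProdC] using .prod (ih₁ ρ) (ih₂ _)
  | abs _ _ _ ih₁ ih₂ ih₃ =>
    intro ρ
    simpa [absC] using .abs (ih₁ ρ) (ih₂ _) (ih₃ _)
  | app _ _ _ _ ih₁ ih₂ ih₃ ih₄ =>
    intro ρ
    simpa [appC] using .app (ih₁ ρ) (ih₂ _) (ih₃ _) (ih₄ _)

theorem InvRel.sub {W : Tm (EConst S)} {M : ETm S} (h : InvRel W M) :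
    ∀ {σ τ}, (∀ n, InvRel (σ n) (τ n)) → InvRel (W.sub σ) (M.sub τ) := by
  have lift : ∀ {σ : Nat → Tm (EConst S)} {τ}, (∀ n, InvRel (σ n) (τ n)) →
      ∀ n, InvRel (Tm.liftSub σ n) (ETm.liftSub τ n) := by
    intro σ τ h n
    cases n
    · exact .var _
    · exact (h _).ren _
  induction h with
  | var n => intro σ τ h; simpa [ETm.sub] using h n
  | u s => intro σ τ _; simpa [ucon] using .u s
  | beta _ _ ih₁ ih₂ =>
    intro σ τ h
    rw [ETm.sub_substAt_zero]
    simpa using .beta (ih₁ (lift h)) (ih₂ h)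
  | prod _ _ ih₁ ih₂ =>
    intro σ τ h
    simpa [ProdC] using .prod (ih₁ h) (ih₂ (lift h))
  | abs _ _ _ ih₁ ih₂ ih₃ =>
    intro σ τ h
    simpa [absC] using .abs (ih₁ h) (ih₂ (lift h)) (ih₃ (lift h))
  | app _ _ _ _ ih₁ ih₂ ih₃ ih₄ =>
    intro σ τ h
    simpa [appC] using .app (ih₁ h) (ih₂ (lift h)) (ih₃ h) (ih₄ h)

theorem InvRel.substAt_zero {V W : Tm (EConst S)} {M N : ETm S} (hM : InvRel W M)
    (hN : InvRel V N) : InvRel (Tm.substAt 0 V W) (ETm.substAt 0 N M) := by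
  rw [ETm.substAt_zero, Tm.substAt_zero]
  refine hM.sub fun n => ?_
  cases n
  · exact hN
  · exact .var _

theorem InvRel.par {W : Tm (EConst S)} {M : ETm S} (h : InvRel W M) :
    ∀ {V}, Par Ar Rr W V → ∃ N, InvRel V N ∧ EConv Rr M N := by
  induction h with
  | var =>
    intro V h
    cases h
    exact ⟨_, .var _, .refl _⟩
  | u s =>
    intro V h
    rcases h.const_inv with ⟨Ns, rfl, hs⟩ | ⟨_, _, _, hc, _⟩ |
      ⟨_, _, _, _, _, _, _, _, _, _, _, _, hc, _⟩
    · cases hs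
      exact ⟨_, .u _, .refl _⟩
    · cases hc
    · cases hc
  | beta _ _ ih₁ ih₂ =>
    intro V h
    cases h with
    | app hM hN =>
      obtain ⟨T, M₂, rfl, -, hM⟩ := hM.lam_inv
      obtain ⟨M₃, h₁, h₂⟩ := ih₁ hM
      obtain ⟨N₃, h₃, h₄⟩ := ih₂ hN
      exact ⟨_, .beta h₁ h₃, h₂.substAt_zero h₄⟩
    | beta hM hN =>
      obtain ⟨M₃, h₁, h₂⟩ := ih₁ hM
      obtain ⟨N₃, h₃, h₄⟩ := ih₂ hN
      exact ⟨_, h₁.substAt_zero h₃, h₂.substAt_zero h₄⟩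
  | prod _ _ ih₁ ih₂ =>
    intro V h
    rcases h.const_inv with ⟨Ns, rfl, hs⟩ | ⟨_, _, _, hc, _⟩ |
      ⟨_, _, _, _, _, _, _, _, _, _, _, _, hc, _⟩
    · simp only [List.forall₂_cons_left_iff, List.forall₂_nil_left_iff] at hs
      obtain ⟨A', _, hA, ⟨X, _, hB, rfl, rfl⟩, rfl⟩ := hs
      obtain ⟨T, B', rfl, -, hB⟩ := hB.lam_inv
      obtain ⟨A₃, h₁, h₂⟩ := ih₁ hA
      obtain ⟨B₃, h₃, h₄⟩ := ih₂ hB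
      exact ⟨_, .prod h₁ h₃, .pi h₂ h₄⟩
    · cases hc
    · cases hc
  | abs _ _ _ ih₁ ih₂ ih₃ =>
    intro V h
    obtain ⟨A', X, Y, rfl, hA, hB, hM⟩ := h.abs_inv
    obtain ⟨T, B', rfl, -, hB⟩ := hB.lam_inv
    obtain ⟨U, M', rfl, -, hM⟩ := hM.lam_inv
    obtain ⟨A₃, h₁, h₂⟩ := ih₁ hA
    obtain ⟨B₃, h₃, h₄⟩ := ih₂ hB
    obtain ⟨M₃, h₅, h₆⟩ := ih₃ hM
    exact ⟨_, .abs h₁ h₃ h₅, .lam h₂ h₄ h₆⟩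
  | app _ _ hInv _ ih₁ ih₂ ih₃ ih₄ =>
    intro V h
    rcases h.const_inv with ⟨Ns, rfl, hs⟩ | ⟨_, _, _, hc, _⟩ |
      ⟨_, _, _, _, _, _, _, _, P', _, Q', hr, hc, hl, rfl, hP, hQ⟩
    · simp only [List.forall₂_cons_left_iff, List.forall₂_nil_left_iff] at hs
      obtain ⟨A', _, hA, ⟨X, _, hB, ⟨M', _, hM, ⟨N', _, hN, rfl, rfl⟩, rfl⟩, rfl⟩, rfl⟩ := hs
      obtain ⟨T, B', rfl, -, hB⟩ := hB.lam_inv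
      obtain ⟨A₃, h₁, h₂⟩ := ih₁ hA
      obtain ⟨B₃, h₃, h₄⟩ := ih₂ hB
      obtain ⟨M₃, h₅, h₆⟩ := ih₃ hM
      obtain ⟨N₃, h₇, h₈⟩ := ih₄ hN
      exact ⟨_, .app h₁ h₃ h₅ h₇, .app h₂ h₄ h₆ h₈⟩
    · cases hc
    · cases hc
      cases hl
      obtain ⟨X, h₁, h₂⟩ := ih₃ (.of_forall₂ (.cons (.refl _) (.cons (.refl _) (.cons hP .nil))))
      obtain ⟨N₃, h₃, h₄⟩ := ih₄ hQ
      cases h₁ with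
      | abs _ _ h₁ =>
        refine ⟨_, .beta h₁ h₃, ?_⟩
        exact .trans (.app (.refl _) (.refl _) h₂ h₄)
          (.rel _ _ (.base ⟨_, _, _, _, _, _, _, _, _, hr, rfl, rfl⟩))

theorem InvRel.pars {W V : Tm (EConst S)} {M : ETm S} (h : InvRel W M)
    (hr : ReflTransGen (Par Ar Rr) W V) : ∃ N, InvRel V N ∧ EConv Rr M N := by
  induction hr with
  | refl => exact ⟨M, h, .refl _⟩
  | tail _ hr ih =>
    obtain ⟨N, h₁, h₂⟩ := ih
    obtain ⟨N', h₃, h₄⟩ := h₁.par hr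
    exact ⟨N', h₃, h₂.trans h₄⟩

theorem econv_of_conv_trans {M N : ETm S} (h : Conv (rulesEPTS Ar Rr) (trans M) (trans N)) :
    EConv Rr M N := by
  obtain ⟨W, h₁, h₂⟩ := h.join
  obtain ⟨M', hM, hM'⟩ := (InvRel.trans M).pars h₁
  obtain ⟨N', hN, hN'⟩ := (InvRel.trans N).pars h₂
  obtain rfl := hM.unique hN
  exact hM'.trans hN'.symm

end InverseTranslation

/-! ## Weakening in the EPTS -/

section Weakening

variable {Ar : S → S → Prop} {Rr : S → S → S → Prop}

/-- `ρ` is a renaming from the context `Γ` into the context `Γ'`. -/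
def IsRen (ρ : Nat → Nat) (Γ Γ' : List (ETm S)) : Prop :=
  ∀ n A, Γ[n]? = some A → ∃ B, Γ'[ρ n]? = some B ∧
    B.ren (· + (ρ n + 1)) = A.ren fun k => ρ (k + (n + 1))

theorem IsRen.id (Γ : List (ETm S)) : IsRen id Γ Γ := fun _ A h => ⟨A, h, rfl⟩

theorem IsRen.succ (Γ : List (ETm S)) (A : ETm S) : IsRen Nat.succ Γ (A :: Γ) :=
  fun _ B h => ⟨B, h, rfl⟩

theorem IsRen.comp {ρ ρ' : Nat → Nat} {Γ Γ' Γ'' : List (ETm S)} (h : IsRen ρ Γ Γ')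
    (h' : IsRen ρ' Γ' Γ'') : IsRen (fun n => ρ' (ρ n)) Γ Γ'' := by
  intro n A hA
  obtain ⟨B, hB, hAB⟩ := h n A hA
  obtain ⟨D, hD, hBD⟩ := h' _ B hB
  refine ⟨D, hD, hBD.trans ?_⟩
  have := congrArg (ETm.ren ρ') hAB
  simpa only [ETm.ren_ren] using this

theorem IsRen.lift {ρ : Nat → Nat} {Γ Γ' : List (ETm S)} (h : IsRen ρ Γ Γ') (A : ETm S) :
    IsRen (Tm.liftRen ρ) (A :: Γ) (A.ren ρ :: Γ') := by
  intro n B hB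
  cases n with
  | zero =>
    obtain rfl : A = B := by simpa using hB
    exact ⟨_, rfl, by rw [ETm.ren_ren]; rfl⟩
  | succ n =>
    obtain ⟨D, hD, hBD⟩ := h n B (by simpa using hB)
    refine ⟨D, by simpa [Tm.liftRen] using hD, ?_⟩
    have := congrArg (ETm.ren Nat.succ) hBD
    simp only [ETm.ren_ren] at this
    exact this

theorem ETm.ren_substAt_zero (M N : ETm S) (ρ : Nat → Nat) :
    (ETm.substAt 0 N M).ren ρ = ETm.substAt 0 (N.ren ρ) (M.ren (Tm.liftRen ρ)) := by
  rw [ETm.ren_eq_sub, ETm.sub_substAt_zero, ETm.liftSub_var, ← ETm.ren_eq_sub, ← ETm.ren_eq_sub]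

theorem ETyped.ren {Γ : List (ETm S)} {M A : ETm S} (h : ETyped Ar Rr Γ M A) :
    ∀ {ρ Γ'}, IsRen ρ Γ Γ' → EWf Ar Rr Γ' → ETyped Ar Rr Γ' (M.ren ρ) (A.ren ρ) := by
  refine ETyped.rec (motive_1 := fun _ _ => True)
    (motive_2 := fun Γ M A _ => ∀ {ρ Γ'}, IsRen ρ Γ Γ' → EWf Ar Rr Γ' →
      ETyped Ar Rr Γ' (M.ren ρ) (A.ren ρ)) trivial (fun _ _ => trivial) ?_ ?_ ?_ ?_ ?_ ?_ h
  · intro Γ s₁ s₂ _ hs _ ρ Γ' _ hΓ'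
    exact .sort hΓ' hs
  · intro Γ n A _ hn _ ρ Γ' hρ hΓ'
    obtain ⟨B, hB, hAB⟩ := hρ n A hn
    rw [ETm.ren_ren, ← hAB]
    exact .var hΓ' hB
  · intro Γ M A B s _ _ hAB ih₁ ih₂ ρ Γ' hρ hΓ'
    exact .conv (ih₁ hρ hΓ') (ih₂ hρ hΓ') (hAB.ren ρ)
  · intro Γ s₁ s₂ s₃ A B hr _ _ ih₁ ih₂ ρ Γ' hρ hΓ'
    exact .pi hr (ih₁ hρ hΓ') (ih₂ (hρ.lift A) (.decl (ih₁ hρ hΓ')))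
  · intro Γ s₁ s₂ s₃ A B M hr _ _ _ ih₁ ih₂ ih₃ ρ Γ' hρ hΓ'
    have hA := ih₁ hρ hΓ'
    exact .lam hr hA (ih₂ (hρ.lift A) (.decl hA)) (ih₃ (hρ.lift A) (.decl hA))
  · intro Γ s₁ s₂ s₃ A B M N hr _ _ _ _ ih₁ ih₂ ih₃ ih₄ ρ Γ' hρ hΓ'
    have hA := ih₁ hρ hΓ'
    rw [ETm.ren_substAt_zero]
    exact .app hr hA (ih₂ (hρ.lift A) (.decl hA)) (ih₃ hρ hΓ') (ih₄ hρ hΓ')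

end Weakening

/-! ## Type families, kinds, and their simple types -/

section Classification

open Relation

variable {Ar : S → S → Prop} {Rr : S → S → S → Prop}

/-- The simple type of a type family or kind. -/
def simpleTy : Tm C → STy
  | .pi A B => .arr (simpleTy A) (simpleTy B)
  | .app A _ => simpleTy A
  | .lam _ B => simpleTy B
  | _ => .star

/-- Pre-kinds (`TyLevel false`) and pre-type-families (`TyLevel true`) of the encoding. -/
inductive TyLevel : Bool → Tm (EConst S) → Prop
  | type : TyLevel false .type
  | U (s Ms) : TyLevel true (.const (.U s) Ms)
  | El (s Ms) : TyLevel true (.const (.El s) Ms)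
  | app {A N} : TyLevel true A → TyLevel true (.app A N)
  | lam {A B} : TyLevel true B → TyLevel true (.lam A B)
  | pi {b A B} : TyLevel true A → TyLevel b B → TyLevel b (.pi A B)

theorem TyLevel.sub {b : Bool} {M : Tm (EConst S)} (h : TyLevel b M) :
    ∀ σ, TyLevel b (M.sub σ) ∧ simpleTy (M.sub σ) = simpleTy M := by
  induction h with
  | type => exact fun σ => ⟨by simpa using .type, by simp⟩
  | U s Ms => exact fun σ => ⟨by simpa using .U _ _, by simp [simpleTy]⟩
  | El s Ms => exact fun σ => ⟨by simpa using .El _ _, by simp [simpleTy]⟩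
  | app _ ih => exact fun σ => ⟨by simpa using .app (ih σ).1, by simpa [simpleTy] using (ih σ).2⟩
  | lam _ ih => exact fun σ => ⟨by simpa using .lam (ih _).1, by simpa [simpleTy] using (ih _).2⟩
  | pi _ _ ih₁ ih₂ =>
    exact fun σ => ⟨by simpa using .pi (ih₁ σ).1 (ih₂ _).1,
      by simpa [simpleTy] using ⟨(ih₁ σ).2, (ih₂ _).2⟩⟩

theorem TyLevel.ren {b : Bool} {M : Tm (EConst S)} (h : TyLevel b M) (ρ : Nat → Nat) :
    TyLevel b (M.ren ρ) := by
  rw [Tm.ren_eq_sub]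
  exact (h.sub _).1

theorem simpleTy_ren (M : Tm (EConst S)) : ∀ ρ, simpleTy (M.ren ρ) = simpleTy M := by
  induction M using Tm.ind with
  | app _ _ ih _ => intro ρ; simpa [simpleTy] using ih ρ
  | lam _ _ _ ih => intro ρ; simpa [simpleTy] using ih _
  | pi _ _ ih₁ ih₂ => intro ρ; simpa [simpleTy] using ⟨ih₁ ρ, ih₂ _⟩
  | _ => intro ρ; simp [simpleTy]

theorem TyLevel.par {b : Bool} {M : Tm (EConst S)} (h : TyLevel b M) :
    ∀ {N}, Par Ar Rr M N → TyLevel b N ∧ simpleTy N = simpleTy M := by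
  induction h with
  | type =>
    intro N h
    cases h
    exact ⟨.type, rfl⟩
  | U s Ms =>
    intro N h
    rcases h.const_inv with ⟨Ns, rfl, hs⟩ | ⟨_, _, _, hc, _⟩ |
      ⟨_, _, _, _, _, _, _, _, _, _, _, _, hc, _⟩
    · exact ⟨.U _ _, rfl⟩
    · cases hc
    · cases hc
  | El s Ms =>
    intro N h
    rcases h.const_inv with ⟨Ns, rfl, hs⟩ | ⟨_, _, _, _, _, rfl⟩ |
      ⟨_, _, _, _, _, _, _, _, _, _, _, _, hc, _⟩
    · exact ⟨.El _ _, rfl⟩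
    · exact ⟨.U _ _, rfl⟩
    · cases hc
  | app _ ih =>
    intro N h
    cases h with
    | app hM hN => exact ⟨.app (ih hM).1, (ih hM).2⟩
    | beta hM hN =>
      obtain ⟨h₁, h₂⟩ := ih (.lam (.refl _) hM)
      cases h₁ with
      | lam h₁ => exact ⟨(h₁.sub _).1, (h₁.sub _).2.trans h₂⟩
  | lam _ ih =>
    intro N h
    cases h with
    | lam hA hM => exact ⟨.lam (ih hM).1, (ih hM).2⟩
  | pi _ _ ih₁ ih₂ =>
    intro N h
    cases h with
    | pi hA hB =>
      exact ⟨.pi (ih₁ hA).1 (ih₂ hB).1, congrArg₂ STy.arr (ih₁ hA).2 (ih₂ hB).2⟩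

theorem TyLevel.pars {b : Bool} {M N : Tm (EConst S)} (h : TyLevel b M)
    (hr : ReflTransGen (Par Ar Rr) M N) : TyLevel b N ∧ simpleTy N = simpleTy M := by
  induction hr with
  | refl => exact ⟨h, rfl⟩
  | tail _ hr ih => exact ⟨(ih.1.par hr).1, (ih.1.par hr).2.trans ih.2⟩

theorem TyLevel.unique {b b' : Bool} {M : Tm (EConst S)} (h : TyLevel b M) (h' : TyLevel b' M) :
    b = b' := by
  induction h with
  | pi _ _ _ ih =>
    cases h' with
    | pi _ h' => exact ih h'
  | _ => cases h'; rfl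

theorem TyLevel.of_conv {b b' : Bool} {M N : Tm (EConst S)} (hM : TyLevel b M)
    (hN : TyLevel b' N) (h : Conv (rulesEPTS Ar Rr) M N) : b = b' ∧ simpleTy M = simpleTy N := by
  obtain ⟨W, h₁, h₂⟩ := h.join
  exact ⟨(hM.pars h₁).1.unique (hN.pars h₂).1, (hM.pars h₁).2.symm.trans (hN.pars h₂).2⟩

theorem TyLevel.not_conv_kind {b : Bool} {M : Tm (EConst S)} (hM : TyLevel b M) :
    ¬ Conv (rulesEPTS Ar Rr) .kind M := by
  intro h
  obtain ⟨W, h₁, h₂⟩ := h.join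
  obtain rfl := pars_kind_inv h₁
  cases (hM.pars h₂).1

/-- The syntactic stratification of well-typed terms into kinds, type families and objects. -/
def Stratified (M T : Tm (EConst S)) : Prop :=
  (T = .kind ∧ TyLevel false M) ∨ (TyLevel false T ∧ TyLevel true M) ∨ TyLevel true T

theorem Stratified.tyLevel_of_isDKSort {A s : Tm (EConst S)} (h : Stratified A s)
    (hs : IsDKSort s) : (s = .type ∧ TyLevel true A) ∨ (s = .kind ∧ TyLevel false A) := by
  rcases hs with rfl | rfl <;> rcases h with ⟨h, h'⟩ | ⟨h, h'⟩ | h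
  · cases h
  · exact .inl ⟨rfl, h'⟩
  · cases h
  · exact .inr ⟨rfl, h'⟩
  · cases h
  · cases h

theorem Stratified.tyLevel_type {A : Tm (EConst S)} (h : Stratified A .type) : TyLevel true A := by
  rcases h.tyLevel_of_isDKSort (.inl rfl) with ⟨_, h⟩ | ⟨h, _⟩
  · exact h
  · cases h

theorem Typed.stratified {Γ : List (Tm (EConst S))} {M T : Tm (EConst S)}
    (h : Typed (sigEPTS Ar Rr) (rulesEPTS Ar Rr) Γ M T) :
    (∀ A ∈ Γ, TyLevel true A) → Stratified M T := by
  refine Typed.rec (motive_1 := fun _ _ => True)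
    (motive_2 := fun Γ M T _ => (∀ A ∈ Γ, TyLevel true A) → Stratified M T)
    (motive_3 := fun _ _ _ _ => True) trivial (fun _ _ => trivial) ?_ ?_ ?_ ?_ ?_ ?_ ?_
    trivial (fun _ _ _ _ => trivial) h
  · exact fun _ _ _ => .inl ⟨rfl, .type⟩
  · exact fun _ hn _ hΓ => .inr (.inr ((hΓ _ (List.mem_of_getElem? hn)).ren _))
  · intro Γ c Δ A s Ms hc _ _ _ _ _ _
    cases hc with
    | U s => exact .inr (.inl ⟨by simpa [instArgs] using .type, .U _ _⟩)
    | El s => exact .inr (.inl ⟨by simpa [instArgs] using .type, .El _ _⟩)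
    | u | Prod => exact .inr (.inr (TyLevel.sub (.U _ _) _).1)
    | abs | app => exact .inr (.inr (TyLevel.sub (.El _ _) _).1)
  · intro Γ M A B s _ _ hs hAB ih₁ ih₂ hΓ
    rcases (ih₂ hΓ).tyLevel_of_isDKSort hs with ⟨-, hB⟩ | ⟨-, hB⟩ <;>
      rcases ih₁ hΓ with ⟨rfl, _⟩ | ⟨hA, hM⟩ | hA
    · exact (hB.not_conv_kind hAB).elim
    · cases (hA.of_conv hB hAB).1
    · exact .inr (.inr hB)
    · exact (hB.not_conv_kind hAB).elim
    · exact .inr (.inl ⟨hB, hM⟩)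
    · cases (hA.of_conv hB hAB).1
  · intro Γ A B s _ _ hs ih₁ ih₂ hΓ
    have hA := (ih₁ hΓ).tyLevel_type
    rcases (ih₂ (List.forall_mem_cons.2 ⟨hA, hΓ⟩)).tyLevel_of_isDKSort hs with
      ⟨rfl, hB⟩ | ⟨rfl, hB⟩
    · exact .inr (.inl ⟨.type, .pi hA hB⟩)
    · exact .inl ⟨rfl, .pi hA hB⟩
  · intro Γ A B s M _ _ hs _ ih₁ ih₂ ih₃ hΓ
    have hA := (ih₁ hΓ).tyLevel_type
    have hΓ' := List.forall_mem_cons.2 ⟨hA, hΓ⟩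
    rcases (ih₂ hΓ').tyLevel_of_isDKSort hs with ⟨-, hB⟩ | ⟨-, hB⟩
    · exact .inr (.inr (.pi hA hB))
    · rcases ih₃ hΓ' with ⟨rfl, _⟩ | ⟨_, hM⟩ | hB'
      · cases hB
      · exact .inr (.inl ⟨.pi hA hB, .lam hM⟩)
      · cases hB.unique hB'
  · intro Γ M N A B _ _ ih₁ _ hΓ
    rcases ih₁ hΓ with ⟨h, _⟩ | ⟨h, hM⟩ | h
    · cases h
    · cases h with
      | pi _ hB => exact .inr (.inl ⟨(hB.sub _).1, .app hM⟩)
    · cases h with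
      | pi _ hB => exact .inr (.inr (hB.sub _).1)

end Classification

/-! ## Normal forms with their inverse translation -/

section NormalForms

open Relation

variable {Ar : S → S → Prop} {Rr : S → S → S → Prop}

/-- β-normal terms without application nodes. -/
inductive AppFree : Tm C → Prop
  | var (n) : AppFree (.var n)
  | const {c Ms} : (∀ M ∈ Ms, AppFree M) → AppFree (.const c Ms)
  | lam {A M} : AppFree A → AppFree M → AppFree (.lam A M)

theorem AppFree.betaNormal {M : Tm C} (h : AppFree M) : BetaNormal M := by
  have root : ∀ {M N : Tm C}, AppFree M → ¬ BetaRoot M N := by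
    rintro _ _ h ⟨A, P, Q, rfl, rfl⟩
    cases h
  induction h with
  | var n =>
    intro N h
    cases h with
    | base h => exact root (.var n) h
  | const hMs ih =>
    intro N h
    generalize hW : Tm.const _ _ = W at h
    cases h with
    | base h => exact root (.const hMs) (hW ▸ h)
    | constArg h =>
      cases hW
      exact ih _ (by simp) _ h
    | _ => cases hW
  | lam hA hM ihA ihM =>
    intro N h
    cases h with
    | base h => exact root (.lam hA hM) h
    | lamA h => exact ihA _ h
    | lamM h => exact ihM _ h

theorem AppFree.ren {M : Tm C} (h : AppFree M) : ∀ ρ, AppFree (M.ren ρ) := by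
  induction h with
  | var n => intro ρ; simpa using .var _
  | const _ ih =>
    intro ρ
    rw [Tm.ren_const]
    refine .const fun M hM => ?_
    obtain ⟨N, hN, rfl⟩ := List.mem_map.1 hM
    exact ih N hN ρ
  | lam _ _ ih₁ ih₂ => intro ρ; simpa using .lam (ih₁ ρ) (ih₂ _)

/-- `NormalInv Ar Rr M M'`: the term `M` is a β-normal invertible form with inverse translation
`M'`, and the annotations of its binders are convertible to those of `⟦M'⟧`. -/
inductive NormalInv (Ar : S → S → Prop) (Rr : S → S → S → Prop) :
    Tm (EConst S) → ETm S → Prop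
  | var (n) : NormalInv Ar Rr (.var n) (.var n)
  | u (s) : NormalInv Ar Rr (ucon s) (.sort s)
  | prod {s₁ s₂ A A' T B B'} : NormalInv Ar Rr A A' → AppFree T →
      Conv (rulesEPTS Ar Rr) T (Elcon s₁ (trans A')) → NormalInv Ar Rr B B' →
      NormalInv Ar Rr (ProdC s₁ s₂ A (.lam T B)) (.pi s₁ s₂ A' B')
  | abs {s₁ s₂ A A' T B B' U M M'} : NormalInv Ar Rr A A' → AppFree T →
      Conv (rulesEPTS Ar Rr) T (Elcon s₁ (trans A')) → NormalInv Ar Rr B B' → AppFree U →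
      Conv (rulesEPTS Ar Rr) U (Elcon s₁ (trans A')) → NormalInv Ar Rr M M' →
      NormalInv Ar Rr (absC s₁ s₂ A (.lam T B) (.lam U M)) (.lam s₁ s₂ A' B' M')
  | app {s₁ s₂ A A' T B B' M M' N N'} : NormalInv Ar Rr A A' → AppFree T →
      Conv (rulesEPTS Ar Rr) T (Elcon s₁ (trans A')) → NormalInv Ar Rr B B' →
      NormalInv Ar Rr M M' → NormalInv Ar Rr N N' →
      NormalInv Ar Rr (appC s₁ s₂ A (.lam T B) M N) (.app s₁ s₂ A' B' M' N')

theorem NormalInv.appFree {M : Tm (EConst S)} {M' : ETm S} (h : NormalInv Ar Rr M M') :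
    AppFree M := by
  induction h with
  | var n => exact .var n
  | u s => exact .const (by simp)
  | prod _ hT _ _ ih₁ ih₂ => exact .const (by simpa using ⟨ih₁, .lam hT ih₂⟩)
  | abs _ hT _ _ hU _ _ ih₁ ih₂ ih₃ =>
    exact .const (by simpa using ⟨ih₁, .lam hT ih₂, .lam hU ih₃⟩)
  | app _ hT _ _ _ _ ih₁ ih₂ ih₃ ih₄ =>
    exact .const (by simpa using ⟨ih₁, .lam hT ih₂, ih₃, ih₄⟩)

theorem NormalInv.inv_eq {M : Tm (EConst S)} {M' : ETm S} (h : NormalInv Ar Rr M M') :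
    inv M = some M' := by
  induction h with
  | var n => simp [inv]
  | u s => simp [inv, ucon]
  | prod _ _ _ _ ih₁ ih₂ => simp [inv, ProdC, ih₁, ih₂]
  | abs _ _ _ _ _ _ _ ih₁ ih₂ ih₃ => simp [inv, absC, ih₁, ih₂, ih₃]
  | app _ _ _ _ _ _ ih₁ ih₂ ih₃ ih₄ => simp [inv, appC, ih₁, ih₂, ih₃, ih₄]

theorem NormalInv.hconv {M : Tm (EConst S)} {M' : ETm S} (h : NormalInv Ar Rr M M') :
    HConv (rulesEPTS Ar Rr) M (trans M') := by
  induction h with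
  | var n => exact .refl _
  | u s => exact .refl _
  | prod _ _ hT _ ih₁ ih₂ => exact eqvGen_const (.cons ih₁ (.cons (HConv.lam_of_conv hT ih₂) .nil))
  | abs _ _ hT _ _ hU _ ih₁ ih₂ ih₃ =>
    exact eqvGen_const
      (.cons ih₁ (.cons (HConv.lam_of_conv hT ih₂) (.cons (HConv.lam_of_conv hU ih₃) .nil)))
  | app _ _ hT _ _ _ ih₁ ih₂ ih₃ ih₄ =>
    exact eqvGen_const
      (.cons ih₁ (.cons (HConv.lam_of_conv hT ih₂) (.cons ih₃ (.cons ih₄ .nil))))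

theorem Elcon_trans_ren (s : S) (A : ETm S) (ρ : Nat → Nat) :
    (Elcon s (trans A)).ren ρ = Elcon s (trans (A.ren ρ)) := by
  simp [Elcon, trans_ren]

theorem NormalInv.ren {M : Tm (EConst S)} {M' : ETm S} (h : NormalInv Ar Rr M M') :
    ∀ ρ, NormalInv Ar Rr (M.ren ρ) (M'.ren ρ) := by
  induction h with
  | var n => intro ρ; simpa [ETm.ren] using .var _
  | u s => intro ρ; simpa [ETm.ren, ucon] using .u s
  | prod _ hT hTA _ ih₁ ih₂ =>
    intro ρ
    simpa [ProdC, ETm.ren] using .prod (ih₁ ρ) (hT.ren ρ) (Elcon_trans_ren _ _ ρ ▸ hTA.ren ρ) (ih₂ _)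
  | abs _ hT hTA _ hU hUA _ ih₁ ih₂ ih₃ =>
    intro ρ
    simpa [absC, ETm.ren] using .abs (ih₁ ρ) (hT.ren ρ) (Elcon_trans_ren _ _ ρ ▸ hTA.ren ρ) (ih₂ _)
      (hU.ren ρ) (Elcon_trans_ren _ _ ρ ▸ hUA.ren ρ) (ih₃ _)
  | app _ hT hTA _ _ _ ih₁ ih₂ ih₃ ih₄ =>
    intro ρ
    simpa [appC, ETm.ren] using .app (ih₁ ρ) (hT.ren ρ) (Elcon_trans_ren _ _ ρ ▸ hTA.ren ρ) (ih₂ _)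
      (ih₃ ρ) (ih₄ ρ)

/-- `M` has a β-normal form whose inverse translation has type `A` in the EPTS. -/
def HasTypedNF (Ar : S → S → Prop) (Rr : S → S → S → Prop) (Γ : List (ETm S))
    (M : Tm (EConst S)) (A : ETm S) : Prop :=
  ∃ M₀ M', ReflTransGen Beta M M₀ ∧ NormalInv Ar Rr M₀ M' ∧ ETyped Ar Rr Γ M' A

theorem HasTypedNF.expand {Γ : List (ETm S)} {M N : Tm (EConst S)} {A : ETm S}
    (hr : ReflTransGen Beta M N) (h : HasTypedNF Ar Rr Γ N A) : HasTypedNF Ar Rr Γ M A :=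
  have ⟨M₀, M', h₁, h₂⟩ := h
  ⟨M₀, M', hr.trans h₁, h₂⟩

theorem HasTypedNF.ren {Γ Γ' : List (ETm S)} {M : Tm (EConst S)} {A : ETm S} {ρ : Nat → Nat}
    (h : HasTypedNF Ar Rr Γ M A) (hρ : IsRen ρ Γ Γ') (hΓ' : EWf Ar Rr Γ') :
    HasTypedNF Ar Rr Γ' (M.ren ρ) (A.ren ρ) :=
  have ⟨M₀, M', h₁, h₂, h₃⟩ := h
  ⟨M₀.ren ρ, M'.ren ρ, betas_ren h₁ ρ, h₂.ren ρ, h₃.ren hρ hΓ'⟩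

/-- The Dedukti type `T` represents the EPTS type `A`. -/
def Represents (Ar : S → S → Prop) (Rr : S → S → S → Prop) (Γ : List (ETm S))
    (T : Tm (EConst S)) (A : ETm S) : Prop :=
  (∃ s, Conv (rulesEPTS Ar Rr) T (Ucon s) ∧ A = .sort s) ∨
  ∃ s, Conv (rulesEPTS Ar Rr) T (Elcon s (trans A)) ∧ ETyped Ar Rr Γ A (.sort s)

theorem Represents.conv {Γ : List (ETm S)} {T U : Tm (EConst S)} {A : ETm S}
    (h : Represents Ar Rr Γ T A) (hTU : Conv (rulesEPTS Ar Rr) T U) : Represents Ar Rr Γ U A := by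
  rcases h with ⟨s, h, hA⟩ | ⟨s, h, hA⟩
  · exact .inl ⟨s, hTU.symm.trans h, hA⟩
  · exact .inr ⟨s, hTU.symm.trans h, hA⟩

theorem Represents.ren {Γ Γ' : List (ETm S)} {T : Tm (EConst S)} {A : ETm S} {ρ : Nat → Nat}
    (h : Represents Ar Rr Γ T A) (hρ : IsRen ρ Γ Γ') (hΓ' : EWf Ar Rr Γ') :
    Represents Ar Rr Γ' (T.ren ρ) (A.ren ρ) := by
  rcases h with ⟨s, h, rfl⟩ | ⟨s, h, hA⟩
  · exact .inl ⟨s, by simpa [Ucon] using h.ren ρ, rfl⟩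
  · exact .inr ⟨s, Elcon_trans_ren s A ρ ▸ h.ren ρ, hA.ren hρ hΓ'⟩

theorem Represents.not_conv_type {Γ : List (ETm S)} {T : Tm (EConst S)} {A : ETm S}
    (h : Represents Ar Rr Γ T A) : ¬ Conv (rulesEPTS Ar Rr) T .type := by
  intro hT
  rcases h with ⟨s, h, _⟩ | ⟨s, h, _⟩
  · exact not_conv_type_Ucon (hT.symm.trans h)
  · exact not_conv_type_Elcon (hT.symm.trans h)

theorem Represents.transport {Γ : List (ETm S)} {T : Tm (EConst S)} {M A B : ETm S}
    (hΓ : EWf Ar Rr Γ) (hA : Represents Ar Rr Γ T A) (hB : Represents Ar Rr Γ T B)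
    (hM : ETyped Ar Rr Γ M A) : ETyped Ar Rr Γ M B := by
  rcases hA with ⟨s, hA, rfl⟩ | ⟨s, hA, _⟩ <;> rcases hB with ⟨s', hB, rfl⟩ | ⟨s', hB, hB'⟩ <;>
    have h := hA.symm.trans hB
  · exact conv_Ucon_inj h ▸ hM
  · exact .conv hM hB' (econv_of_conv_trans (conv_Ucon_Elcon h).2).symm
  · exact .conv hM (.sort hΓ (conv_Ucon_Elcon h.symm).1)
      (econv_of_conv_trans (N := .sort s') (conv_Ucon_Elcon h.symm).2)
  · exact .conv hM hB' (econv_of_conv_trans (conv_Elcon_Elcon h))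

theorem HasTypedNF.transport {Γ : List (ETm S)} {M T : Tm (EConst S)} {A B : ETm S}
    (h : HasTypedNF Ar Rr Γ M A) (hΓ : EWf Ar Rr Γ) (hA : Represents Ar Rr Γ T A)
    (hB : Represents Ar Rr Γ T B) : HasTypedNF Ar Rr Γ M B :=
  have ⟨M₀, M', h₁, h₂, h₃⟩ := h
  ⟨M₀, M', h₁, h₂, hA.transport hΓ hB h₃⟩

end NormalForms

/-! ## The logical relation -/

section LogicalRelation

open Relation

variable {Ar : S → S → Prop} {Rr : S → S → S → Prop}

/-- Types that are weakly head normalizing, with normalizing `El`-arguments. -/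
def ReducibleType (Ar : S → S → Prop) (Rr : S → S → S → Prop) (Γ : List (ETm S))
    (T : Tm (EConst S)) : Prop :=
  (∃ s, ReflTransGen Beta T (Ucon s)) ∨
  (∃ s M, ReflTransGen Beta T (Elcon s M) ∧ HasTypedNF Ar Rr Γ M (.sort s)) ∨
  ∃ A B, ReflTransGen Beta T (.pi A B)

theorem ReducibleType.expand {Γ : List (ETm S)} {T U : Tm (EConst S)}
    (hr : ReflTransGen Beta T U) (h : ReducibleType Ar Rr Γ U) : ReducibleType Ar Rr Γ T := by
  rcases h with ⟨s, h⟩ | ⟨s, M, h, hM⟩ | ⟨A, B, h⟩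
  · exact .inl ⟨s, hr.trans h⟩
  · exact .inr (.inl ⟨s, M, hr.trans h, hM⟩)
  · exact .inr (.inr ⟨A, B, hr.trans h⟩)

theorem ReducibleType.ren {Γ Γ' : List (ETm S)} {T : Tm (EConst S)} {ρ : Nat → Nat}
    (h : ReducibleType Ar Rr Γ T) (hρ : IsRen ρ Γ Γ') (hΓ' : EWf Ar Rr Γ') :
    ReducibleType Ar Rr Γ' (T.ren ρ) := by
  rcases h with ⟨s, h⟩ | ⟨s, M, h, hM⟩ | ⟨A, B, h⟩
  · exact .inl ⟨s, by simpa [Ucon] using betas_ren h ρ⟩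
  · exact .inr (.inl ⟨s, M.ren ρ, by simpa [Elcon] using betas_ren h ρ, hM.ren hρ hΓ'⟩)
  · exact .inr (.inr ⟨A.ren ρ, B.ren (Tm.liftRen ρ), by simpa using betas_ren h ρ⟩)

theorem ReducibleType.exists_appFree {Γ : List (ETm S)} {T N : Tm (EConst S)} {s : S}
    (h : ReducibleType Ar Rr Γ T) (hT : Conv (rulesEPTS Ar Rr) T (Elcon s N)) :
    ∃ T₀, ReflTransGen Beta T T₀ ∧ AppFree T₀ ∧ Conv (rulesEPTS Ar Rr) T₀ (Elcon s N) := by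
  rcases h with ⟨s', h⟩ | ⟨s', M, h, M₀, _, h₁, h₂, _⟩ | ⟨A, B, h⟩
  · exact ⟨Ucon s', h, .const (by simp), (conv_of_betas h).symm.trans hT⟩
  · have h' : ReflTransGen Beta T (Elcon s' M₀) := h.trans (reflTransGen_const (.cons h₁ .nil))
    exact ⟨_, h', .const (by simpa using h₂.appFree), (conv_of_betas h').symm.trans hT⟩
  · exact (not_conv_pi_Elcon ((conv_of_betas h).symm.trans hT)).elim

/-- Reducibility of the term `M` at the Dedukti type `T`, by recursion on the simple type of `T`. -/
def Reducible (Ar : S → S → Prop) (Rr : S → S → S → Prop) :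
    STy → List (ETm S) → Tm (EConst S) → Tm (EConst S) → Prop
  | .star, Γ, T, M =>
      (Conv (rulesEPTS Ar Rr) T .type ∧ ReducibleType Ar Rr Γ M) ∨
      ∃ A, Represents Ar Rr Γ T A ∧ HasTypedNF Ar Rr Γ M A
  | .arr σ τ, Γ, T, M =>
      ∃ A B T₁ P, Conv (rulesEPTS Ar Rr) T (.pi A B) ∧ ReflTransGen Beta M (.lam T₁ P) ∧
        ReducibleType Ar Rr Γ T₁ ∧ Conv (rulesEPTS Ar Rr) T₁ A ∧
        ∀ Γ' ρ N, EWf Ar Rr Γ' → IsRen ρ Γ Γ' → Reducible Ar Rr σ Γ' (A.ren ρ) N →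
          Reducible Ar Rr τ Γ' (B.sub (scons N fun n => .var (ρ n)))
            (P.sub (scons N fun n => .var (ρ n)))

theorem Reducible.conv {σ : STy} {Γ : List (ETm S)} {T U M : Tm (EConst S)}
    (h : Reducible Ar Rr σ Γ T M) (hTU : Conv (rulesEPTS Ar Rr) T U) :
    Reducible Ar Rr σ Γ U M := by
  cases σ with
  | star =>
    rcases h with ⟨hT, h⟩ | ⟨A, hA, h⟩
    · exact .inl ⟨hTU.symm.trans hT, h⟩
    · exact .inr ⟨A, hA.conv hTU, h⟩
  | arr σ τ =>
    obtain ⟨A, B, T₁, P, hT, h⟩ := h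
    exact ⟨A, B, T₁, P, hTU.symm.trans hT, h⟩

theorem Reducible.expand {σ : STy} {Γ : List (ETm S)} {T M N : Tm (EConst S)}
    (hr : ReflTransGen Beta M N) (h : Reducible Ar Rr σ Γ T N) : Reducible Ar Rr σ Γ T M := by
  cases σ with
  | star =>
    rcases h with ⟨hT, h⟩ | ⟨A, hA, h⟩
    · exact .inl ⟨hT, h.expand hr⟩
    · exact .inr ⟨A, hA, h.expand hr⟩
  | arr σ τ =>
    obtain ⟨A, B, T₁, P, hT, hM, h⟩ := h
    exact ⟨A, B, T₁, P, hT, hr.trans hM, h⟩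

theorem sub_scons_var_ren (M N : Tm C) (ρ ρ' : Nat → Nat) :
    (M.ren (Tm.liftRen ρ)).sub (scons N fun n => .var (ρ' n)) =
      M.sub (scons N fun n => .var (ρ' (ρ n))) := by
  rw [Tm.sub_ren]
  congr 1
  funext n
  cases n <;> rfl

theorem Reducible.ren {σ : STy} {Γ Γ' : List (ETm S)} {T M : Tm (EConst S)} {ρ : Nat → Nat}
    (h : Reducible Ar Rr σ Γ T M) (hρ : IsRen ρ Γ Γ') (hΓ' : EWf Ar Rr Γ') :
    Reducible Ar Rr σ Γ' (T.ren ρ) (M.ren ρ) := by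
  cases σ with
  | star =>
    rcases h with ⟨hT, h⟩ | ⟨A, hA, h⟩
    · exact .inl ⟨by simpa using hT.ren ρ, h.ren hρ hΓ'⟩
    · exact .inr ⟨A.ren ρ, hA.ren hρ hΓ', h.ren hρ hΓ'⟩
  | arr σ τ =>
    obtain ⟨A, B, T₁, P, hT, hM, hT₁, hTA, h⟩ := h
    refine ⟨A.ren ρ, B.ren (Tm.liftRen ρ), T₁.ren ρ, P.ren (Tm.liftRen ρ),
      by simpa using hT.ren ρ, by simpa using betas_ren hM ρ, hT₁.ren hρ hΓ', hTA.ren ρ, ?_⟩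
    intro Γ'' ρ' N hΓ'' hρ' hN
    rw [sub_scons_var_ren, sub_scons_var_ren]
    exact h Γ'' _ N hΓ'' (hρ.comp hρ') (by rwa [Tm.ren_ren] at hN)

theorem Reducible.app {σ τ : STy} {Γ : List (ETm S)} {A B M N : Tm (EConst S)}
    (hΓ : EWf Ar Rr Γ) (hM : Reducible Ar Rr (.arr σ τ) Γ (.pi A B) M)
    (hN : Reducible Ar Rr σ Γ A N) : Reducible Ar Rr τ Γ (Tm.substAt 0 N B) (.app M N) := by
  obtain ⟨A', B', T₁, P, hT, hM, -, -, h⟩ := hM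
  obtain ⟨hA, hB⟩ := conv_pi_inj hT
  have hP := h Γ _ N hΓ (.id Γ) (by simpa [Tm.ren_eq_sub] using hN.conv hA)
  rw [Tm.substAt_zero]
  refine (hP.conv (hB.symm.sub _)).expand ?_
  refine (reflTransGen_app hM .refl).tail (.base ⟨T₁, P, N, rfl, ?_⟩)
  rw [Tm.substAt_zero]
  rfl

theorem Reducible.hasTypedNF {Γ : List (ETm S)} {T M : Tm (EConst S)} {A : ETm S}
    (h : Reducible Ar Rr .star Γ T M) (hΓ : EWf Ar Rr Γ) (hT : Represents Ar Rr Γ T A) :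
    HasTypedNF Ar Rr Γ M A := by
  rcases h with ⟨h, _⟩ | ⟨B, hB, h⟩
  · exact (hT.not_conv_type h).elim
  · exact h.transport hΓ hB hT

theorem Reducible.reducibleType {Γ : List (ETm S)} {M : Tm (EConst S)}
    (h : Reducible Ar Rr .star Γ .type M) : ReducibleType Ar Rr Γ M := by
  rcases h with ⟨_, h⟩ | ⟨B, hB, _⟩
  · exact h
  · exact (hB.not_conv_type (.refl _)).elim

theorem Reducible.var_zero {Γ : List (ETm S)} {A : ETm S} {s : S}
    (hA : ETyped Ar Rr Γ A (.sort s)) :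
    Reducible Ar Rr .star (A :: Γ) (Elcon s (trans (A.ren Nat.succ))) (.var 0) :=
  .inr ⟨A.ren Nat.succ, .inr ⟨s, .refl _, hA.ren (.succ Γ A) (.decl hA)⟩,
    .var 0, .var 0, .refl, .var 0, .var (.decl hA) rfl⟩

theorem Reducible.exists_lam {τ : STy} {Γ : List (ETm S)} {A B M : Tm (EConst S)} {A' : ETm S}
    {s : S} (h : Reducible Ar Rr (.arr .star τ) Γ (.pi A B) M)
    (hA' : ETyped Ar Rr Γ A' (.sort s)) (hA : Conv (rulesEPTS Ar Rr) A (Elcon s (trans A'))) :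
    ∃ T P, ReflTransGen Beta M (.lam T P) ∧ AppFree T ∧
      Conv (rulesEPTS Ar Rr) T (Elcon s (trans A')) ∧ Reducible Ar Rr τ (A' :: Γ) B P := by
  obtain ⟨A₁, B₁, T₁, P, hT, hM, hT₁, hTA, h⟩ := h
  obtain ⟨hA₁, hB₁⟩ := conv_pi_inj hT
  obtain ⟨T, hT₁T, hTf, hT⟩ := hT₁.exists_appFree (hTA.trans (hA₁.symm.trans hA))
  refine ⟨T, P, hM.trans (reflTransGen_lam hT₁T .refl), hTf, hT, ?_⟩
  have hid : (scons (.var 0) fun n => .var (Nat.succ n) : Nat → Tm (EConst S)) = .var := by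
    funext n
    cases n <;> rfl
  have hP := h (A' :: Γ) Nat.succ (.var 0) (.decl hA') (.succ Γ A')
    ((Reducible.var_zero hA').conv (Elcon_trans_ren s A' _ ▸ (hA.symm.trans hA₁).ren _))
  rw [hid, Tm.sub_var_id, Tm.sub_var_id] at hP
  exact hP.conv hB₁.symm

end LogicalRelation

/-! ## Reducibility of the constants -/

section Constants

open Relation

variable {Ar : S → S → Prop} {Rr : S → S → S → Prop}

theorem NormalInv.conv_trans {M M₀ : Tm (EConst S)} {M' : ETm S} (h : NormalInv Ar Rr M₀ M')
    (hr : ReflTransGen Beta M M₀) : Conv (rulesEPTS Ar Rr) M (trans M') :=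
  (conv_of_betas hr).trans h.hconv.conv

theorem reducible_Elcon {Γ : List (ETm S)} {s : S} {M : Tm (EConst S)} (hΓ : EWf Ar Rr Γ)
    (h : Reducible Ar Rr .star Γ (Ucon s) M) : Reducible Ar Rr .star Γ .type (Elcon s M) :=
  .inl ⟨.refl _, .inr (.inl ⟨s, M, .refl, h.hasTypedNF hΓ (.inl ⟨s, .refl _, rfl⟩)⟩)⟩

theorem reducible_ucon {Γ : List (ETm S)} {s₁ s₂ : S} (hΓ : EWf Ar Rr Γ) (h : Ar s₁ s₂) :
    Reducible Ar Rr .star Γ (Ucon s₂) (ucon s₁) :=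
  .inr ⟨.sort s₂, .inl ⟨s₂, .refl _, rfl⟩, _, _, .refl, .u s₁, .sort hΓ h⟩

theorem Reducible.exists_family {Γ : List (ETm S)} {s₁ s₂ : S} {A B : Tm (EConst S)}
    (hΓ : EWf Ar Rr Γ) (hA : Reducible Ar Rr .star Γ (Ucon s₁) A)
    (hB : Reducible Ar Rr (.arr .star .star) Γ (.pi (Elcon s₁ A) (Ucon s₂)) B) :
    ∃ A₀ A' T B₀ B', ReflTransGen Beta A A₀ ∧ NormalInv Ar Rr A₀ A' ∧
      ETyped Ar Rr Γ A' (.sort s₁) ∧ ReflTransGen Beta B (.lam T B₀) ∧ AppFree T ∧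
      Conv (rulesEPTS Ar Rr) T (Elcon s₁ (trans A')) ∧ NormalInv Ar Rr B₀ B' ∧
      ETyped Ar Rr (A' :: Γ) B' (.sort s₂) := by
  obtain ⟨A₀, A', hA₀, hAA', hA'⟩ := hA.hasTypedNF hΓ (.inl ⟨s₁, .refl _, rfl⟩)
  obtain ⟨T, P, hP, hT, hTA, hPr⟩ := hB.exists_lam hA' (conv_Elcon (hAA'.conv_trans hA₀))
  obtain ⟨B₀, B', hB₀, hBB', hB'⟩ := hPr.hasTypedNF (.decl hA') (.inl ⟨s₂, .refl _, rfl⟩)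
  exact ⟨A₀, A', T, B₀, B', hA₀, hAA', hA', hP.trans (reflTransGen_lam .refl hB₀), hT, hTA,
    hBB', hB'⟩

theorem reducible_ProdC {Γ : List (ETm S)} {s₁ s₂ s₃ : S} {A B : Tm (EConst S)}
    (hΓ : EWf Ar Rr Γ) (hr : Rr s₁ s₂ s₃) (hA : Reducible Ar Rr .star Γ (Ucon s₁) A)
    (hB : Reducible Ar Rr (.arr .star .star) Γ (.pi (Elcon s₁ A) (Ucon s₂)) B) :
    Reducible Ar Rr .star Γ (Ucon s₃) (ProdC s₁ s₂ A B) := by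
  obtain ⟨A₀, A', T, B₀, B', hA₀, hAA', hA', hB₀, hT, hTA, hBB', hB'⟩ := hA.exists_family hΓ hB
  exact .inr ⟨.sort s₃, .inl ⟨s₃, .refl _, rfl⟩, _, _,
    reflTransGen_const (.cons hA₀ (.cons hB₀ .nil)), .prod hAA' hT hTA hBB', .pi hr hA' hB'⟩

theorem conv_ProdC_trans {s₁ s₂ : S} {A B T B₀ : Tm (EConst S)} {A' B' : ETm S}
    (hA : Conv (rulesEPTS Ar Rr) A (trans A')) (hB : ReflTransGen Beta B (.lam T B₀))
    (hT : Conv (rulesEPTS Ar Rr) T (Elcon s₁ (trans A'))) (hBB' : NormalInv Ar Rr B₀ B') :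
    Conv (rulesEPTS Ar Rr) (ProdC s₁ s₂ A B) (trans (.pi s₁ s₂ A' B')) :=
  eqvGen_const (.cons hA (.cons
    ((conv_of_betas hB).trans (eqvGen_lam hT hBB'.hconv.conv)) .nil))

theorem conv_app_of_betas_lam {B T B₀ N : Tm (EConst S)} {B' N' : ETm S}
    (hB : ReflTransGen Beta B (.lam T B₀)) (hBB' : NormalInv Ar Rr B₀ B')
    (hN : Conv (rulesEPTS Ar Rr) N (trans N')) :
    Conv (rulesEPTS Ar Rr) (.app B N) (trans (ETm.substAt 0 N' B')) := by
  rw [trans_substAt_zero]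
  exact .trans (eqvGen_app ((conv_of_betas hB).trans (eqvGen_lam (.refl _) hBB'.hconv.conv)) hN)
    (conv_beta T _ _)

theorem reducible_absC {Γ : List (ETm S)} {s₁ s₂ s₃ : S} {A B M : Tm (EConst S)}
    (hΓ : EWf Ar Rr Γ) (hr : Rr s₁ s₂ s₃) (hA : Reducible Ar Rr .star Γ (Ucon s₁) A)
    (hB : Reducible Ar Rr (.arr .star .star) Γ (.pi (Elcon s₁ A) (Ucon s₂)) B)
    (hM : Reducible Ar Rr (.arr .star .star) Γ
      (.pi (Elcon s₁ A) (Elcon s₂ (.app (B.ren Nat.succ) (.var 0)))) M) :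
    Reducible Ar Rr .star Γ (Elcon s₃ (ProdC s₁ s₂ A B)) (absC s₁ s₂ A B M) := by
  obtain ⟨A₀, A', T, B₀, B', hA₀, hAA', hA', hB₀, hT, hTA, hBB', hB'⟩ := hA.exists_family hΓ hB
  have hAc := hAA'.conv_trans hA₀
  obtain ⟨U, P, hP, hU, hUA, hPr⟩ := hM.exists_lam hA' (conv_Elcon hAc)
  have hbody : Conv (rulesEPTS Ar Rr) (.app (B.ren Nat.succ) (.var 0)) (trans B') := by
    have := conv_app_of_betas_lam (N' := .var 0) (by simpa using betas_ren hB₀ Nat.succ)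
      (hBB'.ren _) (.refl (.var 0))
    rw [ETm.substAt_zero, ETm.sub_ren] at this
    convert this
    rw [← ETm.sub_var_id B', ETm.sub_sub]
    congr 1
    funext n
    cases n <;> rfl
  obtain ⟨M₀, M', hM₀, hMM', hM'⟩ :=
    hPr.hasTypedNF (.decl hA') (.inr ⟨s₂, conv_Elcon hbody, hB'⟩)
  exact .inr ⟨.pi s₁ s₂ A' B',
    .inr ⟨s₃, conv_Elcon (conv_ProdC_trans hAc hB₀ hTA hBB'), .pi hr hA' hB'⟩, _, _,
    reflTransGen_const (.cons hA₀ (.cons hB₀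
      (.cons (hP.trans (reflTransGen_lam .refl hM₀)) .nil))),
    .abs hAA' hT hTA hBB' hU hUA hMM', .lam hr hA' hB' hM'⟩

theorem reducible_appC {Γ : List (ETm S)} {s₁ s₂ s₃ : S} {A B M N : Tm (EConst S)}
    (hΓ : EWf Ar Rr Γ) (hr : Rr s₁ s₂ s₃) (hA : Reducible Ar Rr .star Γ (Ucon s₁) A)
    (hB : Reducible Ar Rr (.arr .star .star) Γ (.pi (Elcon s₁ A) (Ucon s₂)) B)
    (hM : Reducible Ar Rr .star Γ (Elcon s₃ (ProdC s₁ s₂ A B)) M)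
    (hN : Reducible Ar Rr .star Γ (Elcon s₁ A) N) :
    Reducible Ar Rr .star Γ (Elcon s₂ (.app B N)) (appC s₁ s₂ A B M N) := by
  obtain ⟨A₀, A', T, B₀, B', hA₀, hAA', hA', hB₀, hT, hTA, hBB', hB'⟩ := hA.exists_family hΓ hB
  have hAc := hAA'.conv_trans hA₀
  obtain ⟨M₀, M', hM₀, hMM', hM'⟩ := hM.hasTypedNF hΓ
    (.inr ⟨s₃, conv_Elcon (conv_ProdC_trans hAc hB₀ hTA hBB'), .pi hr hA' hB'⟩)
  obtain ⟨N₀, N', hN₀, hNN', hN'⟩ := hN.hasTypedNF hΓ (.inr ⟨s₁, conv_Elcon hAc, hA'⟩)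
  obtain ⟨D₀, D', hD₀, hDD', hD'⟩ := (hB.app hΓ hN).hasTypedNF hΓ
    (.inl ⟨s₂, by simpa [Ucon, Tm.substAt_zero] using .refl _, rfl⟩)
  have hD := hDD'.conv_trans hD₀
  refine .inr ⟨D', .inr ⟨s₂, conv_Elcon hD, hD'⟩, _, _,
    reflTransGen_const (.cons hA₀ (.cons hB₀ (.cons hM₀ (.cons hN₀ .nil)))),
    .app hAA' hT hTA hBB' hMM' hNN', .conv (.app hr hA' hB' hN' hM') hD' ?_⟩
  exact econv_of_conv_trans
    ((conv_app_of_betas_lam hB₀ hBB' (hNN'.conv_trans hN₀)).symm.trans hD)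

end Constants

/-! ## The fundamental lemma -/

section Fundamental

variable {Ar : S → S → Prop} {Rr : S → S → S → Prop}

/-- The substitution `σ` maps the variables of `Δ` to reducible terms. -/
def ReducibleSub (Ar : S → S → Prop) (Rr : S → S → S → Prop) (Γ : List (ETm S))
    (σ : Nat → Tm (EConst S)) (Δ : List (Tm (EConst S))) : Prop :=
  ∀ n A, Δ[n]? = some A →
    Reducible Ar Rr (simpleTy A) Γ ((A.ren (· + (n + 1))).sub σ) (σ n)

theorem ReducibleSub.scons {Γ Γ' : List (ETm S)} {σ : Nat → Tm (EConst S)}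
    {Δ : List (Tm (EConst S))} {A N : Tm (EConst S)} {ρ : Nat → Nat}
    (h : ReducibleSub Ar Rr Γ σ Δ) (hρ : IsRen ρ Γ Γ') (hΓ' : EWf Ar Rr Γ')
    (hN : Reducible Ar Rr (simpleTy A) Γ' ((A.sub σ).ren ρ) N) :
    ReducibleSub Ar Rr Γ' (scons N fun n => (σ n).ren ρ) (A :: Δ) := by
  intro n B hB
  rw [Tm.sub_ren]
  cases n with
  | zero =>
    obtain rfl : A = B := by simpa using hB
    rwa [Tm.ren_sub] at hN
  | succ n =>
    have := (h n B (by simpa using hB)).ren hρ hΓ'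
    rwa [Tm.sub_ren, Tm.ren_sub] at this

/-- The arguments `Ms` satisfy `P` with respect to the telescope `Δ`. -/
inductive ArgsForall (P : Tm C → Tm C → Prop) : List (Tm C) → List (Tm C) → Prop
  | nil : ArgsForall P [] []
  | cons {M Ms A Δ} : P M A → ArgsForall P Ms (instTele M Δ) → ArgsForall P (M :: Ms) (A :: Δ)

theorem Reducible.const {Γ : List (ETm S)} {σ : Nat → Tm (EConst S)} {c : EConst S}
    {Δ Ms : List (Tm (EConst S))} {A : Tm (EConst S)} (hΓ : EWf Ar Rr Γ)
    (hc : (c, Δ, A) ∈ sigEPTS Ar Rr)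
    (hMs : ArgsForall (fun M A => A ≠ .kind →
      Reducible Ar Rr (simpleTy A) Γ (A.sub σ) (M.sub σ)) Ms Δ) :
    Reducible Ar Rr (simpleTy (instArgs Ms A)) Γ ((instArgs Ms A).sub σ)
      ((Tm.const c Ms).sub σ) := by
  have hid : ∀ M : Tm (EConst S), M.ren (fun n => n) = M := fun M => by
    rw [Tm.ren_eq_sub, Tm.sub_var_id]
  cases hc with
  | U s =>
    cases hMs
    simpa [instArgs, simpleTy, Reducible] using .inl ⟨.refl _, .inl ⟨s, .refl⟩⟩
  | El s =>
    rcases hMs with _ | ⟨hM, hMs⟩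
    cases hMs
    simpa [instArgs, simpleTy, Elcon] using
      reducible_Elcon hΓ (by simpa [simpleTy, Ucon] using hM)
  | u h =>
    cases hMs
    simpa [instArgs, simpleTy, Ucon, ucon] using reducible_ucon hΓ h
  | Prod h =>
    rcases hMs with _ | ⟨hA, hMs⟩
    rcases hMs with _ | ⟨hB, hMs⟩
    cases hMs
    simp [simpleTy, Tm.substAt, Ucon, Elcon, hid] at hA hB
    simpa [instArgs, simpleTy, Ucon, ProdC] using reducible_ProdC hΓ h hA hB
  | abs h =>
    rcases hMs with _ | ⟨hA, hMs⟩
    rcases hMs with _ | ⟨hB, hMs⟩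
    rcases hMs with _ | ⟨hM, hMs⟩
    cases hMs
    simp [simpleTy, Tm.substAt, Ucon, Elcon, Tm.liftSub, Tm.sub_ren, ← Tm.ren_sub, hid] at hA hB hM
    simpa [instArgs, simpleTy, Elcon, ProdC, absC] using reducible_absC hΓ h hA hB hM
  | app h =>
    rcases hMs with _ | ⟨hA, hMs⟩
    rcases hMs with _ | ⟨hB, hMs⟩
    rcases hMs with _ | ⟨hM, hMs⟩
    rcases hMs with _ | ⟨hN, hMs⟩
    cases hMs
    simp [simpleTy, Tm.substAt, Ucon, Elcon, ProdC, Tm.sub_ren, Tm.sub_sub, hid] at hA hB hM hN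
    simpa [instArgs, simpleTy, Elcon, ProdC, appC] using reducible_appC hΓ h hA hB hM hN

theorem Stratified.exists_tyLevel {M T : Tm (EConst S)} (h : Stratified M T) (hT : T ≠ .kind) :
    ∃ b, TyLevel b T := by
  rcases h with ⟨h, _⟩ | ⟨h, _⟩ | h
  · exact (hT h).elim
  · exact ⟨_, h⟩
  · exact ⟨_, h⟩

theorem sub_liftSub_scons_ren (M N : Tm C) (σ : Nat → Tm C) (ρ : Nat → Nat) :
    (M.sub (Tm.liftSub σ)).sub (scons N fun n => .var (ρ n)) =
      M.sub (scons N fun n => (σ n).ren ρ) := by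
  rw [Tm.sub_sub]
  congr 1
  funext n
  cases n with
  | zero => simp [Tm.liftSub]
  | succ n => simp [Tm.liftSub, Tm.sub_ren, Tm.ren_eq_sub (σ n) ρ]

theorem Typed.reducible {Δ : List (Tm (EConst S))} {M T : Tm (EConst S)}
    (h : Typed (sigEPTS Ar Rr) (rulesEPTS Ar Rr) Δ M T) :
    (∀ A ∈ Δ, TyLevel true A) → ∀ Γ σ, EWf Ar Rr Γ → ReducibleSub Ar Rr Γ σ Δ → T ≠ .kind →
      Reducible Ar Rr (simpleTy T) Γ (T.sub σ) (M.sub σ) := by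
  refine Typed.rec (motive_1 := fun _ _ => True)
    (motive_2 := fun Δ M T _ => (∀ A ∈ Δ, TyLevel true A) → ∀ Γ σ, EWf Ar Rr Γ →
      ReducibleSub Ar Rr Γ σ Δ → T ≠ .kind → Reducible Ar Rr (simpleTy T) Γ (T.sub σ) (M.sub σ))
    (motive_3 := fun Δ Ms tele _ => (∀ A ∈ Δ, TyLevel true A) → ∀ Γ σ, EWf Ar Rr Γ →
      ReducibleSub Ar Rr Γ σ Δ → ArgsForall (fun M A => A ≠ .kind →
        Reducible Ar Rr (simpleTy A) Γ (A.sub σ) (M.sub σ)) Ms tele)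
    trivial (fun _ _ => trivial) ?_ ?_ ?_ ?_ ?_ ?_ ?_ ?_ ?_ h
  · exact fun _ _ _ _ _ _ _ hT => (hT rfl).elim
  · intro Δ n A _ hn _ _ Γ σ _ hσ _
    simpa [simpleTy_ren] using hσ n A hn
  · intro Δ c tele A s Ms hc _ _ _ _ ih hΔ Γ σ hΓ hσ _
    exact Reducible.const hΓ hc (ih hΔ Γ σ hΓ hσ)
  · intro Δ M A B s hM hB hs hAB ihM _ hΔ Γ σ hΓ hσ _
    obtain ⟨b, hB'⟩ : ∃ b, TyLevel b B := by
      rcases (hB.stratified hΔ).tyLevel_of_isDKSort hs with ⟨-, h⟩ | ⟨-, h⟩ <;> exact ⟨_, h⟩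
    have hA : A ≠ .kind := by
      rintro rfl
      exact hB'.not_conv_kind hAB
    obtain ⟨b', hA'⟩ := (hM.stratified hΔ).exists_tyLevel hA
    rw [← (hA'.of_conv hB' hAB).2]
    exact (ihM hΔ Γ σ hΓ hσ hA).conv (hAB.sub σ)
  · intro Δ A B s _ _ hs _ _ _ Γ σ _ _ hne
    obtain rfl := hs.resolve_right hne
    simpa [simpleTy, Reducible] using .inl ⟨.refl _, .inr (.inr ⟨_, _, .refl⟩)⟩
  · intro Δ A B s M hA hB hs _ ihA _ ihM hΔ Γ σ hΓ hσ _
    have hΔ' := List.forall_mem_cons.2 ⟨(hA.stratified hΔ).tyLevel_type, hΔ⟩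
    have hB' : B ≠ .kind := by
      rintro rfl
      rcases (hB.stratified hΔ').tyLevel_of_isDKSort hs with ⟨-, h⟩ | ⟨-, h⟩ <;> cases h
    rw [Tm.sub, Tm.sub]
    refine ⟨_, _, _, _, .refl _, .refl, ?_, .refl _, ?_⟩
    · exact Reducible.reducibleType (by simpa [simpleTy] using ihA hΔ Γ σ hΓ hσ (by simp))
    · intro Γ' ρ N hΓ' hρ hN
      have := ihM hΔ' Γ' _ hΓ' (hσ.scons hρ hΓ' hN) hB'
      rwa [sub_liftSub_scons_ren, sub_liftSub_scons_ren]
  · intro Δ M N A B hM _ ihM ihN hΔ Γ σ hΓ hσ _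
    obtain ⟨b, hAB⟩ := (hM.stratified hΔ).exists_tyLevel (by simp)
    cases hAB with
    | pi hA hB =>
      rw [Tm.sub_substAt_zero, Tm.sub, Tm.substAt, (hB.sub _).2]
      exact Reducible.app hΓ (by simpa [simpleTy] using ihM hΔ Γ σ hΓ hσ (by simp))
        (ihN hΔ Γ σ hΓ hσ (by rintro rfl; cases hA))
  · exact fun _ _ _ _ _ => .nil
  · exact fun _ _ ihM ihMs hΔ Γ σ hΓ hσ =>
      .cons (ihM hΔ Γ σ hΓ hσ) (ihMs hΔ Γ σ hΓ hσ)

theorem TransCtx.wf {Γ : List (ETm S)} {Δ : List (Tm (EConst S))} (h : TransCtx Ar Rr Γ Δ) :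
    EWf Ar Rr Γ := by
  cases h with
  | nil => exact .empty
  | cons _ hA => exact .decl hA

theorem TransCtx.tyLevel {Γ : List (ETm S)} {Δ : List (Tm (EConst S))} (h : TransCtx Ar Rr Γ Δ) :
    ∀ A ∈ Δ, TyLevel true A := by
  induction h with
  | nil => simp
  | cons _ _ ih => exact List.forall_mem_cons.2 ⟨.El _ _, ih⟩

theorem TransCtx.reducibleSub {Γ : List (ETm S)} {Δ : List (Tm (EConst S))}
    (h : TransCtx Ar Rr Γ Δ) : ReducibleSub Ar Rr Γ .var Δ := by
  induction h with
  | nil => exact fun n A hA => by simp at hA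
  | @cons Γ Δ A sA _ hA ih =>
    intro n B hB
    rw [Tm.sub_var_id]
    cases n with
    | zero =>
      obtain rfl : Elcon sA (trans A) = B := by simpa using hB
      rw [Elcon_trans_ren]
      exact Reducible.var_zero hA
    | succ n =>
      have := (ih n B (by simpa using hB)).ren (.succ Γ A) (.decl hA)
      rwa [Tm.sub_var_id, Tm.ren_ren, Tm.ren] at this

end Fundamental

/-- Conservativity. -/
theorem conservativity {S : Type} (Ar : S → S → Prop)
    (Rr : S → S → S → Prop) (hfun : FunctionalSpec Ar Rr)
    {Γ : List (ETm S)} {Δ : List (Tm (EConst S))} (hΓ : TransCtx Ar Rr Γ Δ)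
    {A : ETm S} (hA : ETypeJ Ar Rr Γ A)
    {M T : Tm (EConst S)}
    (hT : (∃ s, A = ETm.sort s ∧ IsTopSort Ar s ∧ T = Ucon s) ∨
          (∃ sA, ETyped Ar Rr Γ A (ETm.sort sA) ∧ T = Elcon sA (trans A)))
    (h : Typed (sigEPTS Ar Rr) (rulesEPTS Ar Rr) Δ M T) :
    ∃ M₀, Relation.ReflTransGen Beta M M₀ ∧ BetaNormal M₀ ∧
      ∃ M', inv M₀ = some M' ∧ ETyped Ar Rr Γ M' A ∧
        HConv (rulesEPTS Ar Rr) M₀ (trans M') := by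
  obtain ⟨hRep, hstar, hkind⟩ : Represents Ar Rr Γ T A ∧ simpleTy T = .star ∧ T ≠ .kind := by
    rcases hT with ⟨s, rfl, _, rfl⟩ | ⟨s, hA, rfl⟩
    · exact ⟨.inl ⟨s, .refl _, rfl⟩, rfl, by simp [Ucon]⟩
    · exact ⟨.inr ⟨s, .refl _, hA⟩, rfl, by simp [Elcon]⟩
  have hM := h.reducible hΓ.tyLevel Γ .var hΓ.wf hΓ.reducibleSub hkind
  rw [hstar, Tm.sub_var_id, Tm.sub_var_id] at hM
  obtain ⟨M₀, M', hr, hinv, hM'⟩ := hM.hasTypedNF hΓ.wf hRep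
  exact ⟨M₀, hr, hinv.appFree.betaNormal, M', hinv.inv_eq, hM', hinv.hconv⟩

end DKPaper
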